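/- arXiv:2409.11082 — 4 statements merged into one kernel-verified Lean document; each statement's English description precedes it below -/
import Mathlib

section
/- Neither the field ℚ^{tr,2} nor the field ℚ^{tr,3} admits a universal quadratic form (in any number of variables). -/
open Polynomial NumberField

set_option synthInstance.maxHeartbeats 400000
set_option maxHeartbeats 400000

noncomputable section

/-- `z : ℂ` is a totally real algebraic number: it is algebraic over `ℚ` and all of its
conjugates over `ℚ` (i.e. the complex roots of its minimal polynomial over `ℚ`) are real. -/
def IsTotallyRealNum (z : ℂ) : Prop :=
  IsAlgebraic ℚ z ∧ ∀ w : ℂ, aeval w (minpoly ℚ z) = 0 → w.im = 0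

/-- `z : ℂ` is a totally positive algebraic number: it is algebraic over `ℚ` and all of its
conjugates over `ℚ` are positive real numbers. -/
def IsTotallyPositive (z : ℂ) : Prop :=
  IsAlgebraic ℚ z ∧ ∀ w : ℂ, aeval w (minpoly ℚ z) = 0 → 0 < w.re ∧ w.im = 0

/-- `ℚ^{tr,n}`: the compositum (inside `ℂ`) of all totally real number fields of degree at
most `n` over `ℚ`. -/
def QtrDeg (n : ℕ) : Subfield ℂ :=
  Subfield.closure {x : ℂ | ∃ F : Subfield ℂ, (∀ y : ↥F, IsTotallyRealNum ↑y) ∧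
    FiniteDimensional ℚ ↥F ∧ Module.finrank ℚ ↥F ≤ n ∧ x ∈ F}

/-- `Q` is a universal quadratic form over `K` (in `n` variables): a homogeneous quadratic
polynomial with coefficients in `𝓞_K` which is positive definite and represents every
totally positive element of `𝓞_K`. -/
def IsUniversalForm (K : Subfield ℂ) {n : ℕ} (Q : MvPolynomial (Fin n) (𝓞 ↥K)) : Prop :=
  Q.IsHomogeneous 2 ∧
  (∀ x : Fin n → 𝓞 ↥K, x ≠ 0 → IsTotallyPositive ((MvPolynomial.eval x Q : ↥K) : ℂ)) ∧
  (∀ α : 𝓞 ↥K, IsTotallyPositive ((α : ↥K) : ℂ) → ∃ x : Fin n → 𝓞 ↥K,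
    MvPolynomial.eval x Q = α)

open scoped commutatorElement

/-- The field of algebraic numbers inside `ℂ`. -/
abbrev AlgNum : Subfield ℂ := (algebraicClosure ℚ ℂ).toSubfield

lemma mem_algNum_iff {z : ℂ} : z ∈ AlgNum ↔ IsAlgebraic ℚ z := mem_algebraicClosure_iff

instance : Algebra.IsAlgebraic ℚ ↥AlgNum where
  isAlgebraic z := (isAlgebraic_algebraMap_iff (algebraMap ↥AlgNum ℂ).injective).1
    (mem_algNum_iff.1 z.2)

instance : IsAlgClosed ↥AlgNum :=
  (algebraicClosure.isAlgClosure ℚ ℂ).isAlgClosed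

instance : IsAlgClosure ℚ ↥AlgNum := ⟨inferInstance, inferInstance⟩

instance : Normal ℚ ↥AlgNum := IsAlgClosure.normal ℚ ↥AlgNum

instance : IsGalois ℚ ↥AlgNum where

/-- The absolute Galois group of `ℚ`, acting on the algebraic numbers in `ℂ`. -/
abbrev AbsGal : Type := ↥AlgNum ≃ₐ[ℚ] ↥AlgNum

/-- The algebraic numbers fixed by the cubes of all commutators of the absolute Galois group. -/
def cubedCommutatorField : Subfield ↥AlgNum where
  carrier := {z | ∀ σ τ : AbsGal, (⁅σ, τ⁆ ^ 3 : AbsGal) z = z}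
  mul_mem' ha hb σ τ := by rw [map_mul, ha, hb]
  one_mem' σ τ := map_one _
  add_mem' ha hb σ τ := by rw [map_add, ha, hb]
  zero_mem' σ τ := map_zero _
  neg_mem' ha σ τ := by rw [map_neg, ha]
  inv_mem' z ha σ τ := by rw [map_inv₀, ha]

lemma mem_cubedCommutatorField {z : ↥AlgNum} :
    z ∈ cubedCommutatorField ↔ ∀ σ τ : AbsGal, (⁅σ, τ⁆ ^ 3 : AbsGal) z = z := Iff.rfl

lemma minpoly_algNum_coe (z : ↥AlgNum) : minpoly ℚ (z : ℂ) = minpoly ℚ z :=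
  minpoly.algebraMap_eq (algebraMap ↥AlgNum ℂ).injective z

lemma aeval_minpoly_absGal (z : ↥AlgNum) (σ : AbsGal) :
    aeval ((σ z : ↥AlgNum) : ℂ) (minpoly ℚ (z : ℂ)) = 0 := by
  rw [minpoly_algNum_coe]
  have h : aeval (σ z) (minpoly ℚ z) = 0 := by
    rw [aeval_algHom_apply σ z, minpoly.aeval, map_zero]
  exact (aeval_algebraMap_apply ℂ (σ z) (minpoly ℚ z)).trans (by rw [h, map_zero])

lemma exists_absGal_of_aeval_minpoly (z : ↥AlgNum) {w : ℂ}
    (hw : aeval w (minpoly ℚ (z : ℂ)) = 0) : ∃ σ : AbsGal, ((σ z : ↥AlgNum) : ℂ) = w := by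
  have hz : IsIntegral ℚ z := Algebra.IsIntegral.isIntegral z
  rw [minpoly_algNum_coe] at hw
  have hmem : w ∈ AlgNum :=
    mem_algNum_iff.2 ⟨minpoly ℚ z, minpoly.ne_zero hz, hw⟩
  have h : aeval (⟨w, hmem⟩ : ↥AlgNum) (minpoly ℚ z) = 0 := by
    apply (algebraMap ↥AlgNum ℂ).injective
    rw [← aeval_algebraMap_apply, map_zero]
    exact hw
  obtain ⟨σ, hσ⟩ := minpoly.exists_algEquiv_of_root' hz.isAlgebraic h
  exact ⟨σ, by rw [hσ]⟩

open scoped ComplexOrder in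
lemma isTotallyPositive_algNum_iff (z : ↥AlgNum) :
    IsTotallyPositive z ↔ ∀ σ : AbsGal, 0 < ((σ z : ↥AlgNum) : ℂ) := by
  refine ⟨fun h σ ↦ ?_, fun h ↦ ⟨mem_algNum_iff.1 z.2, fun w hw ↦ ?_⟩⟩
  · obtain ⟨h1, h2⟩ := h.2 _ (aeval_minpoly_absGal z σ)
    exact Complex.pos_iff.2 ⟨h1, h2.symm⟩
  · obtain ⟨σ, rfl⟩ := exists_absGal_of_aeval_minpoly z hw
    obtain ⟨h1, h2⟩ := Complex.pos_iff.1 (h σ)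
    exact ⟨h1, h2.symm⟩

set_option maxRecDepth 100000 in
lemma perm_commutator_pow_three {α : Type*} [Finite α] (h : Nat.card α ≤ 3)
    (a b : Equiv.Perm α) : ⁅a, b⁆ ^ 3 = 1 := by
  have key : ∀ m ≤ 3, ∀ a b : Equiv.Perm (Fin m), ⁅a, b⁆ ^ 3 = 1 := by
    intro m hm
    interval_cases m <;> decide
  let e := (Finite.equivFin α).permCongrHom
  apply e.injective
  rw [map_pow, map_commutatorElement, map_one]
  exact key _ h _ _

lemma mem_cubedCommutatorField_of_natDegree_le (z : ↥AlgNum)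
    (hz : (minpoly ℚ z).natDegree ≤ 3) : z ∈ cubedCommutatorField := by
  have hint : IsIntegral ℚ z := Algebra.IsIntegral.isIntegral z
  have hsub : MulAction.orbit AbsGal z ⊆ (minpoly ℚ z).rootSet ↥AlgNum := by
    rintro _ ⟨σ, rfl⟩
    rw [mem_rootSet]
    refine ⟨minpoly.ne_zero hint, ?_⟩
    change aeval (σ z) (minpoly ℚ z) = 0
    rw [aeval_algHom_apply σ z, minpoly.aeval, map_zero]
  have hfin : ((minpoly ℚ z).rootSet ↥AlgNum).Finite := rootSet_finite _ _
  have : Finite (MulAction.orbit AbsGal z) := hfin.subset hsub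
  have hcard : Nat.card (MulAction.orbit AbsGal z) ≤ 3 := by
    rw [Nat.card_coe_set_eq]
    exact (Set.ncard_le_ncard hsub hfin).trans ((ncard_rootSet_le _ _).trans hz)
  intro σ τ
  have h := perm_commutator_pow_three hcard
    (MulAction.toPermHom AbsGal (MulAction.orbit AbsGal z) σ)
    (MulAction.toPermHom AbsGal (MulAction.orbit AbsGal z) τ)
  rw [← map_commutatorElement, ← map_pow] at h
  generalize ⁅σ, τ⁆ ^ 3 = g at h ⊢
  exact congrArg Subtype.val (DFunLike.congr_fun h ⟨z, MulAction.mem_orbit_self z⟩)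

lemma absGal_comm_apply_of_pow_eq_one {z : ↥AlgNum} {n : ℕ} (hn : 0 < n) (hz : z ^ n = 1)
    (σ τ : AbsGal) : σ (τ z) = τ (σ z) := by
  have : NeZero (orderOf z) := ⟨(orderOf_pos_iff.2 (isOfFinOrder_iff_pow_eq_one.2 ⟨n, hn, hz⟩)).ne'⟩
  have key : ∀ ρ : AbsGal, ∃ i : ℕ, ρ z = z ^ i := fun ρ ↦ by
    obtain ⟨i, -, hi⟩ := (IsPrimitiveRoot.orderOf z).eq_pow_of_pow_eq_one (ξ := ρ z)
      (by rw [← map_pow, pow_orderOf_eq_one, map_one])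
    exact ⟨i, hi.symm⟩
  obtain ⟨i, hi⟩ := key σ
  obtain ⟨j, hj⟩ := key τ
  rw [hj, hi, map_pow, map_pow, hi, hj, ← pow_mul, ← pow_mul, mul_comm]

lemma mem_cubedCommutatorField_of_pow_eq_one {z : ↥AlgNum} {n : ℕ} (hn : 0 < n)
    (hz : z ^ n = 1) : z ∈ cubedCommutatorField := by
  intro σ τ
  have h : ⁅σ, τ⁆ z = z := by
    have := absGal_comm_apply_of_pow_eq_one (z := σ⁻¹ (τ⁻¹ z)) hn
      (by rw [← map_pow, ← map_pow, hz, map_one, map_one]) σ τ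
    change σ (τ (σ⁻¹ (τ⁻¹ z))) = z
    rw [this]
    change τ ((σ * σ⁻¹) (τ⁻¹ z)) = z
    rw [mul_inv_cancel]
    change (τ * τ⁻¹) z = z
    rw [mul_inv_cancel]
    rfl
  change ⁅σ, τ⁆ (⁅σ, τ⁆ (⁅σ, τ⁆ z)) = z
  rw [h, h, h]

lemma Complex.norm_eq_one_of_sq_sub_mul_add_one {v w : ℂ} (hre : 0 ≤ (v ^ 2).re)
    (him : (v ^ 2).im = 0) (hle : (v ^ 2).re ≤ 4) (hw : w ^ 2 - v * w + 1 = 0) : ‖w‖ = 1 := by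
  obtain ⟨a, b⟩ := v
  obtain ⟨x, y⟩ := w
  simp only [pow_two, Complex.mul_re, Complex.mul_im] at hre him hle
  have h1 := congrArg Complex.re hw
  have h2 := congrArg Complex.im hw
  simp only [pow_two, Complex.mul_re, Complex.mul_im, Complex.add_re, Complex.sub_re,
    Complex.add_im, Complex.sub_im, Complex.one_re, Complex.one_im, Complex.zero_re,
    Complex.zero_im] at h1 h2
  have hb : b = 0 := by
    have hab : a * b = 0 := by linarith
    rcases mul_eq_zero.1 hab with h | h
    · subst h; nlinarith
    · exact h
  subst hb
  have hn : x ^ 2 + y ^ 2 = 1 := by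
    have h3 : y * (2 * x - a) = 0 := by linarith
    rcases mul_eq_zero.1 h3 with h | h
    · subst h
      have h4 : x = a / 2 := by nlinarith [sq_nonneg (x - a / 2)]
      subst h4; nlinarith
    · have h4 : a = 2 * x := by linarith
      subst h4; nlinarith
  rw [Complex.norm_eq_sqrt_sq_add_sq, hn, Real.sqrt_one]

lemma exists_pow_eq_one_of_norm_absGal_eq_one {z : ↥AlgNum} (hz : IsIntegral ℤ z)
    (h : ∀ σ : AbsGal, ‖((σ z : ↥AlgNum) : ℂ)‖ = 1) : ∃ n : ℕ, 0 < n ∧ z ^ n = 1 := by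
  have hzQ : IsIntegral ℚ z := Algebra.IsIntegral.isIntegral z
  let K : IntermediateField ℚ ↥AlgNum := IntermediateField.adjoin ℚ {z}
  have hfd : FiniteDimensional ℚ ↥K := IntermediateField.adjoin.finiteDimensional hzQ
  have hnf : NumberField ↥K := { to_charZero := inferInstance, to_finiteDimensional := by convert hfd }
  let g : ↥K := IntermediateField.AdjoinSimple.gen ℚ z
  have hg : IsIntegral ℤ g := by
    have : Function.Injective K.val := K.val.injective
    exact (isIntegral_algHom_iff (K.val.toRingHom.toIntAlgHom) this).1 hz
  obtain ⟨n, hn, hpow⟩ := NumberField.Embeddings.pow_eq_one_of_norm_eq_one ↥K ℂ hg (fun φ ↦ by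
    have hroot : aeval (φ g) (minpoly ℚ (z : ℂ)) = 0 := by
      rw [minpoly_algNum_coe]
      have h0 : eval₂ (algebraMap ℚ ↥K) g (minpoly ℚ z) = 0 :=
        (IntermediateField.minpoly_gen ℚ z) ▸ minpoly.aeval ℚ g
      have h1 := congrArg φ h0
      rw [hom_eval₂, map_zero] at h1
      rw [aeval_def, Subsingleton.elim (algebraMap ℚ ℂ) (φ.comp (algebraMap ℚ ↥K))]
      exact h1
    obtain ⟨σ, hσ⟩ := exists_absGal_of_aeval_minpoly z hroot
    rw [← hσ]
    exact h σ)
  exact ⟨n, hn, congrArg Subtype.val hpow⟩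

open scoped ComplexOrder in
lemma exists_sq_eq_of_absGal_mem_Icc {t : ↥AlgNum} (ht : IsIntegral ℤ t)
    (h0 : ∀ σ : AbsGal, 0 ≤ ((σ t : ↥AlgNum) : ℂ)) (h4 : ∀ σ : AbsGal, ((σ t : ↥AlgNum) : ℂ) ≤ 4) :
    ∃ s ∈ cubedCommutatorField, s ^ 2 = t := by
  obtain ⟨s, hs⟩ := IsAlgClosed.exists_pow_nat_eq t (n := 2) (by norm_num)
  obtain ⟨r, hr⟩ := IsAlgClosed.exists_pow_nat_eq (s ^ 2 - 4) (n := 2) (by norm_num)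
  set x : ↥AlgNum := (s + r) / 2 with hx
  have hxs : x ^ 2 - s * x + 1 = 0 := by rw [hx]; linear_combination hr / 4
  have hx0 : x ≠ 0 := by rintro h; rw [h] at hxs; norm_num at hxs
  have hsint : IsIntegral ℤ s := IsIntegral.of_pow (n := 2) (by norm_num) (hs ▸ ht)
  have hxint : IsIntegral ℤ x := by
    refine isIntegral_trans (A := integralClosure ℤ ↥AlgNum) x ?_
    refine ⟨X ^ 2 - C ⟨s, hsint⟩ * X + 1, by monicity!, ?_⟩
    simpa [eval₂_add, eval₂_sub, eval₂_mul] using hxs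
  obtain ⟨n, hn, hxn⟩ := exists_pow_eq_one_of_norm_absGal_eq_one hxint (fun σ ↦ by
    have hv : ((σ s : ↥AlgNum) : ℂ) ^ 2 = ((σ t : ↥AlgNum) : ℂ) := by
      rw [← hs, map_pow]; rfl
    obtain ⟨hre, him⟩ := Complex.nonneg_iff.1 (h0 σ)
    refine Complex.norm_eq_one_of_sq_sub_mul_add_one (v := ((σ s : ↥AlgNum) : ℂ))
      (by rwa [hv]) (by rw [hv, him]) (by rw [hv]; exact (Complex.le_def.1 (h4 σ)).1) ?_
    have := congrArg (fun y ↦ ((σ y : ↥AlgNum) : ℂ)) hxs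
    simpa using this)
  have hxE := mem_cubedCommutatorField_of_pow_eq_one hn hxn
  refine ⟨s, ?_, hs⟩
  have : s = x + x⁻¹ := by
    field_simp
    linear_combination -hxs
  rw [this]
  exact add_mem hxE (inv_mem hxE)

lemma absGal_eq_or_eq_neg {x : ↥AlgNum} {d : ℚ} (hx : x ^ 2 = d) (σ : AbsGal) :
    σ x = x ∨ σ x = -x := by
  rw [← sq_eq_sq_iff_eq_or_eq_neg, ← map_pow, hx, map_ratCast]

lemma exists_absGal_apply_eq_neg {x : ↥AlgNum} {d : ℚ} (hx : x ^ 2 = d) (hd : ¬ IsSquare d) :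
    ∃ σ : AbsGal, σ x = -x := by
  by_contra! hcon
  have hfix : ∀ σ : AbsGal, σ x = x := fun σ ↦
    (absGal_eq_or_eq_neg hx σ).resolve_right (hcon σ)
  obtain ⟨q, rfl⟩ := (InfiniteGalois.mem_range_algebraMap_iff_fixed (k := ℚ) x).2 hfix
  refine hd ⟨q, ?_⟩
  rw [eq_ratCast] at hx
  rw [← pow_two]
  exact_mod_cast hx.symm

lemma exists_absGal_neg_and_fixed (H : Subgroup AbsGal) {x y : ↥AlgNum} (hx0 : x ≠ 0) (hy0 : y ≠ 0)
    (hx : ∀ σ : AbsGal, σ x = x ∨ σ x = -x) (hy : ∀ σ : AbsGal, σ y = y ∨ σ y = -y)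
    (h1 : ∃ σ ∈ H, σ x = -x) (h2 : ∃ σ ∈ H, σ (x * y) = -(x * y)) :
    ∃ σ ∈ H, σ x = -x ∧ σ y = y := by
  obtain ⟨σ, hσ, hσx⟩ := h1
  obtain ⟨τ, hτ, hτxy⟩ := h2
  rcases hy σ with hσy | hσy
  · exact ⟨σ, hσ, hσx, hσy⟩
  have hne : τ (x * y) ≠ x * y := fun h ↦ mul_ne_zero hx0 hy0 (self_eq_neg.1 (h.symm.trans hτxy))
  rcases hx τ with hτx | hτx <;> rcases hy τ with hτy | hτy
  · exact absurd (by rw [map_mul, hτx, hτy]) hne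
  · refine ⟨σ * τ, mul_mem hσ hτ, ?_, ?_⟩
    · rw [AlgEquiv.mul_apply, hτx, hσx]
    · rw [AlgEquiv.mul_apply, hτy, map_neg, hσy, neg_neg]
  · exact ⟨τ, hτ, hτx, hτy⟩
  · exact absurd (by rw [map_mul, hτx, hτy, neg_mul_neg]) hne

lemma not_isSquare_two_mul_intCast {a : ℤ} (ha : Odd a) : ¬ IsSquare (((2 * a : ℤ)) : ℚ) := by
  rw [Rat.isSquare_intCast_iff]
  rintro ⟨r, hr⟩
  obtain ⟨k, rfl⟩ := ha
  rcases Int.even_or_odd' r with ⟨m, rfl | rfl⟩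
  · have : 2 * (m * m) = 2 * k + 1 := by linarith
    omega
  · have : 2 * (2 * k + 1) = 2 * (2 * m * m + 2 * m) + 1 := by linarith
    omega

lemma exists_absGal_neg_fixed_fixed {x y z : ↥AlgNum} {a b c : ℚ} (hx : x ^ 2 = a)
    (hy : y ^ 2 = b) (hz : z ^ 2 = c) (ha : ¬ IsSquare a) (hb : b ≠ 0) (hc : c ≠ 0)
    (hab : ¬ IsSquare (a * b)) (hac : ¬ IsSquare (a * c)) (habc : ¬ IsSquare (a * b * c)) :
    ∃ σ : AbsGal, σ x = -x ∧ σ y = y ∧ σ z = z := by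
  have ne0 : ∀ {w : ↥AlgNum} {d : ℚ}, w ^ 2 = d → d ≠ 0 → w ≠ 0 := by
    rintro w d hw hd rfl
    rw [zero_pow two_ne_zero] at hw
    exact hd (by exact_mod_cast hw.symm)
  have ha0 : a ≠ 0 := by rintro rfl; exact ha ⟨0, by simp⟩
  have hx0 := ne0 hx ha0
  have hy0 := ne0 hy hb
  have hz0 := ne0 hz hc
  have hxy : (x * y) ^ 2 = ((a * b : ℚ) : ↥AlgNum) := by rw [mul_pow, hx, hy]; push_cast; rfl
  have hxz : (x * z) ^ 2 = ((a * c : ℚ) : ↥AlgNum) := by rw [mul_pow, hx, hz]; push_cast; rfl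
  have hxyz : (x * y * z) ^ 2 = ((a * b * c : ℚ) : ↥AlgNum) := by
    rw [mul_pow, hxy, hz]; push_cast; rfl
  have top {w : ↥AlgNum} {d : ℚ} (hw : w ^ 2 = d) (hd : ¬ IsSquare d) :
      ∃ σ ∈ (⊤ : Subgroup AbsGal), σ w = -w := by
    obtain ⟨σ, h⟩ := exists_absGal_apply_eq_neg hw hd
    exact ⟨σ, Subgroup.mem_top σ, h⟩
  obtain ⟨σ, -, h1, h2⟩ := exists_absGal_neg_and_fixed ⊤ hx0 hz0 (absGal_eq_or_eq_neg hx)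
    (absGal_eq_or_eq_neg hz) (top hx ha) (top hxz hac)
  obtain ⟨τ, -, h3, h4⟩ := exists_absGal_neg_and_fixed ⊤ (mul_ne_zero hx0 hy0) hz0
    (absGal_eq_or_eq_neg hxy) (absGal_eq_or_eq_neg hz) (top hxy hab) (top hxyz habc)
  obtain ⟨ρ, h5, h6, h7⟩ := exists_absGal_neg_and_fixed (MulAction.stabilizer AbsGal z) hx0 hy0
    (absGal_eq_or_eq_neg hx) (absGal_eq_or_eq_neg hy) ⟨σ, h2, h1⟩ ⟨τ, h4, h3⟩
  exact ⟨ρ, h6, h7, h5⟩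

lemma mul_unit_ne_sq_of_mem_cubedCommutatorField {x y : ℤ} {s A B θ : ↥AlgNum} (hs : s ^ 2 = 2)
    (hA : A ^ 2 = 2 * x ^ 2 - 1) (hB : B ^ 2 = 2 * y ^ 2 - 1)
    (hx : ¬ IsSquare (2 * x ^ 2 - 1)) (hxy : ¬ IsSquare ((2 * x ^ 2 - 1) * (2 * y ^ 2 - 1)))
    (hθ : θ ∈ cubedCommutatorField) : θ ^ 2 ≠ (x * s + A) * (y * s + B) := by
  intro hθ2
  have hodd (z : ℤ) : Odd (2 * z ^ 2 - 1) := ⟨z ^ 2 - 1, by ring⟩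
  have hs' : s ^ 2 = (((2 : ℤ) : ℚ) : ↥AlgNum) := by rw [hs]; norm_num
  have hA' : A ^ 2 = (((2 * x ^ 2 - 1 : ℤ) : ℚ) : ↥AlgNum) := by rw [hA]; push_cast; rfl
  have hB' : B ^ 2 = (((2 * y ^ 2 - 1 : ℤ) : ℚ) : ↥AlgNum) := by rw [hB]; push_cast; rfl
  have hne (z : ℤ) : ((2 * z ^ 2 - 1 : ℤ) : ℚ) ≠ 0 := by
    rw [Int.cast_ne_zero]; have := hodd z; rintro h; rw [h] at this; exact absurd this (by decide)
  have h2 {m : ℤ} (hm : Odd m) (q : ℚ) (hq : q = ((2 * m : ℤ) : ℚ)) : ¬ IsSquare q := by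
    rw [hq]; exact not_isSquare_two_mul_intCast hm
  have hAB : ¬ IsSquare (((2 * x ^ 2 - 1 : ℤ) : ℚ) * ((2 * y ^ 2 - 1 : ℤ) : ℚ)) := by
    rw [← Int.cast_mul, Rat.isSquare_intCast_iff]; exact hxy
  obtain ⟨μ, hμs, hμA, hμB⟩ := exists_absGal_neg_fixed_fixed hs' hA' hB'
    (h2 (m := 1) odd_one _ (by norm_num)) (hne x) (hne y)
    (h2 (hodd x) _ (by push_cast; ring)) (h2 (hodd y) _ (by push_cast; ring))
    (h2 ((hodd x).mul (hodd y)) _ (by push_cast; ring))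
  obtain ⟨σ, hσA, hσs, hσB⟩ := exists_absGal_neg_fixed_fixed hA' hs' hB'
    (by rw [Rat.isSquare_intCast_iff]; exact hx) (by norm_num) (hne y)
    (h2 (hodd x) _ (by push_cast; ring)) hAB
    (h2 ((hodd x).mul (hodd y)) _ (by push_cast; ring))
  have hη : (x * s + A) * (A - x * s) = -1 := by linear_combination hA - x ^ 2 * hs
  have hη' : (y * s + B) * (B - y * s) = -1 := by linear_combination hB - y ^ 2 * hs
  have hη0 : x * s + A ≠ 0 := fun h ↦ by rw [h] at hη; norm_num at hη
  have hη0' : y * s + B ≠ 0 := fun h ↦ by rw [h] at hη'; norm_num at hη'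
  have hθ0 : θ ≠ 0 := fun h ↦ by
    rw [h, zero_pow two_ne_zero] at hθ2; exact mul_ne_zero hη0 hη0' hθ2.symm
  have hσθ : σ θ ^ 2 = (x * s - A) * (y * s + B) := by
    rw [← map_pow, hθ2]; simp only [map_mul, map_add, map_intCast, hσA, hσs, hσB]; ring
  have hμθ : μ θ ^ 2 = (A - x * s) * (B - y * s) := by
    rw [← map_pow, hθ2]; simp only [map_mul, map_add, map_intCast, hμA, hμs, hμB]; ring
  obtain ⟨e, he, hp⟩ : ∃ e : ℤ, e ^ 2 = 1 ∧ σ θ * θ = e * (y * s + B) := by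
    have : (σ θ * θ) ^ 2 = (y * s + B) ^ 2 := by
      rw [mul_pow, hσθ, hθ2]; linear_combination (-(y * s + B) ^ 2) * hη
    rcases sq_eq_sq_iff_eq_or_eq_neg.1 this with h | h
    · exact ⟨1, by norm_num, by rw [h]; push_cast; ring⟩
    · exact ⟨-1, by norm_num, by rw [h]; push_cast; ring⟩
  obtain ⟨f, hf, hq⟩ : ∃ f : ℤ, f ^ 2 = 1 ∧ μ θ * θ = f := by
    have : (μ θ * θ) ^ 2 = 1 ^ 2 := by
      rw [mul_pow, hμθ, hθ2]; linear_combination (y * s + B) * (B - y * s) * hη - hη'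
    rcases sq_eq_sq_iff_eq_or_eq_neg.1 this with h | h
    · exact ⟨1, by norm_num, by rw [h]; push_cast; ring⟩
    · exact ⟨-1, by norm_num, by rw [h]; push_cast; ring⟩
  have hP : μ (σ θ) * μ θ = e * (B - y * s) := by
    rw [← map_mul, hp]; simp only [map_mul, map_add, map_intCast, hμs, hμB]; ring
  have hR : σ (μ θ) * σ θ = f := by rw [← map_mul, hq, map_intCast]
  have hanti : σ (μ θ) = -μ (σ θ) := by
    have he' : (e : ↥AlgNum) ^ 2 = 1 := by exact_mod_cast he
    have hf' : (f : ↥AlgNum) ^ 2 = 1 := by exact_mod_cast hf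
    have hf0 : (f : ↥AlgNum) ≠ 0 := fun h ↦ by rw [h] at hf'; norm_num at hf'
    have he0 : (e : ↥AlgNum) ≠ 0 := fun h ↦ by rw [h] at he'; norm_num at he'
    have h1 : σ (μ θ) * (e * (y * s + B)) = f * θ := by
      rw [← hp, ← mul_assoc, hR]
    have h2 : μ (σ θ) * f = e * (B - y * s) * θ := by rw [← hq, ← mul_assoc, hP]
    apply mul_right_cancel₀ (mul_ne_zero (mul_ne_zero he0 hf0) hη0')
    linear_combination f * h1 + e * (y * s + B) * h2 + θ * hf' +
      (y * s + B) * (B - y * s) * θ * he' + θ * hη'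
  have hcomm : ⁅σ⁻¹, μ⁻¹⁆ θ = -θ := by
    have h1 : (σ * μ) θ = -(μ * σ) θ := hanti
    have h2 : ⁅σ⁻¹, μ⁻¹⁆ = (μ * σ)⁻¹ * (σ * μ) := by
      rw [commutatorElement_def, inv_inv, inv_inv, mul_inv_rev, mul_assoc]
    rw [h2, AlgEquiv.mul_apply, h1, map_neg, ← AlgEquiv.mul_apply, inv_mul_cancel,
      AlgEquiv.one_apply]
  have h3 := hθ σ⁻¹ μ⁻¹
  rw [pow_succ, pow_two, AlgEquiv.mul_apply, AlgEquiv.mul_apply, hcomm, map_neg, hcomm, map_neg,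
    map_neg, hcomm, neg_neg] at h3
  exact hθ0 (self_eq_neg.1 h3.symm)

lemma MvPolynomial.IsHomogeneous.exists_quadraticForm {ι R : Type*} [CommRing R]
    {Q : MvPolynomial ι R} (hQ : Q.IsHomogeneous 2) :
    ∃ q : QuadraticForm R (ι → R), ∀ x, q x = MvPolynomial.eval x Q := by
  classical
  have hmon : ∀ d ∈ Q.support, ∃ q : QuadraticForm R (ι → R),
      ∀ x, q x = MvPolynomial.eval x (MvPolynomial.monomial d (Q.coeff d)) := by
    intro d hd
    have hdeg : d.toMultiset.card = 2 := by
      rw [Finsupp.card_toMultiset]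
      have h2 : Finsupp.weight (fun _ ↦ 1) d = 2 := hQ (MvPolynomial.mem_support_iff.1 hd)
      rw [← Finsupp.degree_eq_weight_one] at h2
      exact h2
    obtain ⟨i, j, hij⟩ := Multiset.card_eq_two.1 hdeg
    have hd' : d = Finsupp.single i 1 + Finsupp.single j 1 := by
      rw [← Finsupp.toMultiset_toFinsupp d, hij]
      change Multiset.toFinsupp ({i} + {j}) = _
      rw [map_add, Multiset.toFinsupp_singleton, Multiset.toFinsupp_singleton]
    refine ⟨Q.coeff d • QuadraticMap.linMulLin (LinearMap.proj i) (LinearMap.proj j), fun x ↦ ?_⟩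
    rw [MvPolynomial.eval_monomial, hd', Finsupp.prod_add_index' (by simp) (by simp [pow_add])]
    simp
  choose! q hq using hmon
  refine ⟨∑ d ∈ Q.support, q d, fun x ↦ ?_⟩
  conv_rhs => rw [Q.as_sum]
  rw [sum_apply, map_sum]
  exact Finset.sum_congr rfl fun d hd ↦ hq d hd x

open scoped ComplexOrder in
lemma QuadraticMap.map_polar_sq_mem_Icc {R M : Type*} [CommRing R] [AddCommGroup M] [Module R M]
    (q : QuadraticForm R M) (ψ : R →+* ℂ) (h : ∀ x : M, 0 ≤ ψ (q x)) (x : M) {y : M}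
    (hy : 0 < ψ (q y)) :
    0 ≤ ψ (polar q x y) ^ 2 ∧ ψ (polar q x y) ^ 2 ≤ 4 * (ψ (q x) * ψ (q y)) := by
  have hreal : ∀ z : M, ∃ r : ℝ, 0 ≤ r ∧ ψ (q z) = r := fun z ↦ by
    obtain ⟨h1, h2⟩ := Complex.nonneg_iff.1 (h z)
    exact ⟨_, h1, Complex.ext rfl h2.symm⟩
  have hz : q (((2 * q y) • x) + (-polar q x y) • y) =
      q y * (4 * (q x * q y) - polar q x y ^ 2) := by
    rw [QuadraticMap.map_add q, QuadraticMap.polar_smul_left, QuadraticMap.polar_smul_right,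
      QuadraticMap.map_smul, QuadraticMap.map_smul]
    simp only [smul_eq_mul]
    ring
  obtain ⟨a, ha0, ha⟩ := hreal x
  obtain ⟨b, hb0, hb⟩ := hreal y
  obtain ⟨c, hc0, hc⟩ := hreal (x + y)
  obtain ⟨d, hd0, hd⟩ := hreal (((2 * q y) • x) + (-polar q x y) • y)
  have hb1 : 0 < b := by rw [hb] at hy; exact_mod_cast hy
  have hp : ψ (polar q x y) = ((c - a - b : ℝ) : ℂ) := by
    rw [QuadraticMap.polar, map_sub, map_sub, ha, hb, hc]; push_cast; rfl
  rw [hz] at hd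
  simp only [map_mul, map_sub, map_pow, map_ofNat, ha, hb, hp] at hd
  rw [hp, ha, hb]
  norm_cast at hd ⊢
  refine ⟨sq_nonneg _, ?_⟩
  have := nonneg_of_mul_nonneg_right (hd ▸ hd0) hb1
  linarith

lemma card_le_of_polar_eq_zero {R ι : Type*} [CommRing R] [IsDomain R] [CharZero R] [Fintype ι]
    {n : ℕ} (q : QuadraticForm R (Fin n → R)) (v : ι → Fin n → R) (hv : ∀ i, q (v i) ≠ 0)
    (h : ∀ i j, i ≠ j → QuadraticMap.polar q (v i) (v j) = 0) : Fintype.card ι ≤ n := by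
  classical
  have hli : LinearIndependent R v := by
    rw [Fintype.linearIndependent_iff]
    intro g hg i
    have h1 : QuadraticMap.polarBilin q (∑ j, g j • v j) (v i) = 0 := by
      rw [hg, map_zero, LinearMap.zero_apply]
    rw [map_sum, LinearMap.sum_apply, Finset.sum_eq_single i] at h1
    · rw [map_smul, LinearMap.smul_apply, QuadraticMap.polarBilin_apply_apply,
        QuadraticMap.polar_self, smul_eq_mul] at h1
      exact (mul_eq_zero.1 h1).resolve_right (by simpa using hv i)
    · intro j _ hj
      rw [map_smul, LinearMap.smul_apply, QuadraticMap.polarBilin_apply_apply, h j i hj, smul_zero]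
    · exact fun hi ↦ absurd (Finset.mem_univ i) hi
  simpa using hli.fintype_card_le_finrank

open scoped ComplexOrder in
lemma map_one_add_mul_add_pos {R : Type*} [CommRing R] (ψ : R →+* ℂ) {k : ℤ} (hk : 1 ≤ k)
    {s A : R} (hs : s ^ 2 = 2) (hA : A ^ 2 = 2 * k ^ 2 - 1) :
    0 < ψ ((1 + s) * (k * s + A)) := by
  have hreal : ∀ (z : ℂ) (r : ℝ), 0 ≤ r → z ^ 2 = r → ∃ x : ℝ, z = x ∧ x ^ 2 = r := by
    intro z r hr hz
    have h1 : z ^ 2 = ((√r : ℝ) : ℂ) ^ 2 := by rw [hz]; norm_cast; rw [Real.sq_sqrt hr]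
    rcases sq_eq_sq_iff_eq_or_eq_neg.1 h1 with h | h
    · exact ⟨√r, h, Real.sq_sqrt hr⟩
    · exact ⟨-√r, by rw [h]; push_cast; rfl, by rw [neg_sq, Real.sq_sqrt hr]⟩
  have hk' : (1 : ℝ) ≤ k := by exact_mod_cast hk
  obtain ⟨x, hx, hx2⟩ := hreal (ψ s) 2 (by norm_num) (by rw [← map_pow, hs]; simp [map_ofNat ψ 2])
  obtain ⟨y, hy, hy2⟩ := hreal (ψ A) (2 * k ^ 2 - 1) (by nlinarith)
    (by rw [← map_pow, hA]; simp [map_ofNat ψ 2])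
  simp only [map_mul, map_add, map_one, map_intCast, hx, hy]
  norm_cast
  have hlt : y ^ 2 < (k * x) ^ 2 := by rw [hy2, mul_pow, hx2]; linarith
  rcases le_total 0 x with h | h
  · have h1 := abs_lt.1 (abs_lt_of_sq_lt_sq hlt (by positivity))
    exact mul_pos (by linarith) (by linarith [h1.1])
  · have h1 := abs_lt.1 (abs_lt_of_sq_lt_sq (a := y) (b := -(k * x)) (by rw [neg_sq]; exact hlt) (by nlinarith))
    exact mul_pos_of_neg_of_neg (by nlinarith) (by linarith [h1.2])

/-- A sequence of positive even integers `k` for which the numbers `2 * k ^ 2 - 1` are pairwise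
coprime. -/
def evenSeq : ℕ → ℤ
  | 0 => 2
  | n + 1 => evenSeq n * (2 * evenSeq n ^ 2 - 1)

lemma evenSeq_pos (n : ℕ) : 1 ≤ evenSeq n := by
  induction n with
  | zero => norm_num [evenSeq]
  | succ n ih => rw [evenSeq]; nlinarith

lemma even_evenSeq (n : ℕ) : Even (evenSeq n) := by
  induction n with
  | zero => exact ⟨1, by norm_num [evenSeq]⟩
  | succ n ih => exact ih.mul_right _

lemma dvd_evenSeq {m n : ℕ} (h : m < n) : 2 * evenSeq m ^ 2 - 1 ∣ evenSeq n := by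
  induction n, h using Nat.le_induction with
  | base => exact Dvd.intro_left _ rfl
  | succ n _ ih => exact ih.mul_right _

lemma not_isSquare_evenSeq (n : ℕ) : ¬ IsSquare (2 * evenSeq n ^ 2 - 1) := by
  rintro ⟨r, hr⟩
  obtain ⟨k, hk⟩ := even_evenSeq n
  rw [hk] at hr
  rcases Int.even_or_odd' r with ⟨m, rfl | rfl⟩
  · have : 4 * (2 * k ^ 2 - m * m) = 1 := by linarith
    omega
  · have : 4 * (2 * k ^ 2 - m * m - m) = 2 := by linarith
    omega

lemma not_isSquare_evenSeq_mul {m n : ℕ} (h : m ≠ n) :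
    ¬ IsSquare ((2 * evenSeq m ^ 2 - 1) * (2 * evenSeq n ^ 2 - 1)) := by
  wlog hlt : m < n generalizing m n
  · rw [mul_comm]; exact this h.symm (lt_of_le_of_ne (not_lt.1 hlt) h.symm)
  rintro ⟨r, hr⟩
  have hcop : IsCoprime (2 * evenSeq m ^ 2 - 1) (2 * evenSeq n ^ 2 - 1) := by
    obtain ⟨c, hc⟩ := dvd_evenSeq hlt
    exact ⟨2 * c * evenSeq n, -1, by linear_combination (-2 * evenSeq n) * hc⟩
  obtain ⟨a, ha | ha⟩ := Int.sq_of_gcd_eq_one (Int.isCoprime_iff_gcd_eq_one.1 hcop)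
    (hr.trans (pow_two r).symm)
  · exact not_isSquare_evenSeq m ⟨a, by rw [ha, pow_two]⟩
  · nlinarith [evenSeq_pos m]

open scoped ComplexOrder in
theorem not_exists_isUniversalForm_of_le {K : Subfield ℂ}
    (hK : K ≤ cubedCommutatorField.map AlgNum.subtype) (hs : ∃ s : 𝓞 ↥K, s ^ 2 = 2)
    (hA : ∀ k : ℤ, 1 ≤ k → ∃ A : 𝓞 ↥K, A ^ 2 = 2 * k ^ 2 - 1) :
    ¬ ∃ (n : ℕ) (Q : MvPolynomial (Fin n) (𝓞 ↥K)), IsUniversalForm K Q := by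
  rintro ⟨n, Q, hhom, hpos, huniv⟩
  obtain ⟨s, hs⟩ := hs
  choose A hA using fun i : ℕ ↦ hA (evenSeq i) (evenSeq_pos i)
  obtain ⟨q, hq⟩ := hhom.exists_quadraticForm
  have hKalg : K ≤ AlgNum := fun x hx ↦ by
    obtain ⟨y, -, rfl⟩ := hK hx
    exact y.2
  let J : 𝓞 ↥K →+* ↥AlgNum := (Subfield.inclusion hKalg).comp (algebraMap (𝓞 ↥K) ↥K)
  have hJcoe (r : 𝓞 ↥K) : ((J r : ↥AlgNum) : ℂ) = ((r : ↥K) : ℂ) := rfl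
  have hJinj : Function.Injective J :=
    (Subfield.inclusion hKalg).injective.comp RingOfIntegers.coe_injective
  have hJE (r : 𝓞 ↥K) : J r ∈ cubedCommutatorField := by
    obtain ⟨y, hy, hyr⟩ := hK (r : ↥K).2
    have : y = J r := Subtype.ext hyr
    exact this ▸ hy
  let ψ (σ : AbsGal) : 𝓞 ↥K →+* ℂ := (AlgNum.subtype.comp (σ : ↥AlgNum →+* ↥AlgNum)).comp J
  have hψ (σ : AbsGal) (r : 𝓞 ↥K) : ψ σ r = ((σ (J r) : ↥AlgNum) : ℂ) := rfl
  have hqpos (σ : AbsGal) {x : Fin n → 𝓞 ↥K} (hx : x ≠ 0) : 0 < ψ σ (q x) := by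
    have := hpos x hx
    rw [← hq, ← hJcoe, isTotallyPositive_algNum_iff] at this
    exact this σ
  have hqnonneg (σ : AbsGal) (x : Fin n → 𝓞 ↥K) : 0 ≤ ψ σ (q x) := by
    rcases eq_or_ne x 0 with rfl | hx
    · rw [QuadraticMap.map_zero, map_zero]
    · exact (hqpos σ hx).le
  let u (i : ℕ) : 𝓞 ↥K := (1 + s) * (evenSeq i * s + A i)
  let v (i : ℕ) : 𝓞 ↥K := (s - 1) * (evenSeq i * s - A i)
  have huv (i : ℕ) : u i * v i = 1 := by
    simp only [u, v]
    linear_combination ((evenSeq i : 𝓞 ↥K) ^ 2 * s ^ 2 - A i ^ 2 + evenSeq i ^ 2) * hs - hA i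
  have hupos (σ : AbsGal) (i : ℕ) : 0 < ψ σ (u i) :=
    map_one_add_mul_add_pos (ψ σ) (evenSeq_pos i) hs (hA i)
  choose x hx using fun i : ℕ ↦ huniv (u i) (by
    rw [← hJcoe, isTotallyPositive_algNum_iff]
    exact fun σ ↦ hupos σ i)
  replace hx (i : ℕ) : q (x i) = u i := (hq _).trans (hx i)
  have horth (i j : ℕ) (hij : i ≠ j) : QuadraticMap.polar q (x i) (x j) = 0 := by
    by_contra hb
    set b := QuadraticMap.polar q (x i) (x j) with hbdef
    have hbt : b ^ 2 = b ^ 2 * (v i * v j) * (u i * u j) := by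
      linear_combination (-b ^ 2) * (huv i) - b ^ 2 * u i * v i * huv j
    have hcs (σ : AbsGal) : 0 ≤ ψ σ b ^ 2 ∧ ψ σ b ^ 2 ≤ 4 * (ψ σ (u i) * ψ σ (u j)) := by
      have := QuadraticMap.map_polar_sq_mem_Icc q (ψ σ) (hqnonneg σ) (x i) (y := x j)
        (by rw [hx]; exact hupos σ j)
      rwa [hx, hx] at this
    have hmul (σ : AbsGal) : ψ σ (b ^ 2 * (v i * v j)) * (ψ σ (u i) * ψ σ (u j)) = ψ σ b ^ 2 := by
      rw [← map_mul, ← map_mul, ← hbt, map_pow]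
    obtain ⟨c, hcE, hc⟩ := exists_sq_eq_of_absGal_mem_Icc (t := J (b ^ 2 * (v i * v j)))
      ((RingOfIntegers.isIntegral _).map J.toIntAlgHom)
      (fun σ ↦ le_of_mul_le_mul_right (by rw [zero_mul, ← hψ, hmul]; exact (hcs σ).1)
        (mul_pos (hupos σ i) (hupos σ j)))
      (fun σ ↦ le_of_mul_le_mul_right (by rw [← hψ, hmul]; exact (hcs σ).2)
        (mul_pos (hupos σ i) (hupos σ j)))
    have hJb : J b ≠ 0 := (map_ne_zero_iff J hJinj).2 hb
    have hbc : J b ^ 2 = c ^ 2 * (J (u i) * J (u j)) := by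
      rw [hc, ← map_mul, ← map_mul, ← map_pow, ← hbt]
    have hc0 : c ≠ 0 := by
      rintro rfl
      rw [zero_pow two_ne_zero, zero_mul] at hbc
      exact hJb (pow_eq_zero_iff two_ne_zero |>.1 hbc)
    have hs2 : J s ^ 2 = 2 := by rw [← map_pow, hs, map_ofNat]
    have h1s : 1 + J s ≠ 0 := fun h ↦ by
      have h' : (1 + J s) * (J s - 1) = 1 := by linear_combination hs2
      rw [h, zero_mul] at h'
      exact zero_ne_one h'
    have hA2 (i : ℕ) : J (A i) ^ 2 = 2 * evenSeq i ^ 2 - 1 := by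
      rw [← map_pow, hA, map_sub, map_mul, map_pow, map_ofNat, map_intCast, map_one]
    refine mul_unit_ne_sq_of_mem_cubedCommutatorField (θ := J b / (c * (1 + J s))) hs2 (hA2 i)
      (hA2 j) (not_isSquare_evenSeq i) (not_isSquare_evenSeq_mul hij)
      (div_mem (hJE b) (mul_mem hcE (add_mem (one_mem _) (hJE s)))) ?_
    rw [div_pow, hbc]
    simp only [u, map_mul, map_add, map_one, map_intCast]
    field_simp
  have hcard := card_le_of_polar_eq_zero q (fun i : Fin (n + 1) ↦ x i)
    (fun i ↦ by rw [hx]; exact left_ne_zero_of_mul_eq_one (huv i))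
    (fun i j hij ↦ horth i j (fun h ↦ hij (Fin.ext h)))
  rw [Fintype.card_fin] at hcard
  omega

lemma qtrDeg_le_map_cubedCommutatorField {n : ℕ} (hn : n ≤ 3) :
    QtrDeg n ≤ cubedCommutatorField.map AlgNum.subtype := by
  refine Subfield.closure_le.2 ?_
  rintro x ⟨F, htr, hfd, hdeg, hxF⟩
  have halg : IsAlgebraic ℚ x := (htr ⟨x, hxF⟩).1
  let z : ↥AlgNum := ⟨x, mem_algNum_iff.2 halg⟩
  refine ⟨z, mem_cubedCommutatorField_of_natDegree_le z ?_, rfl⟩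
  rw [← minpoly_algNum_coe]
  have h := minpoly.natDegree_le (A := ℚ) (⟨x, hxF⟩ : ↥F)
  rw [← minpoly.algebraMap_eq (algebraMap ↥F ℂ).injective] at h
  exact (h.trans hdeg).trans hn

lemma exists_rat_add_mul_of_mem_adjoin {z : ℂ} {d : ℚ} (hz : z ^ 2 = d) {y : ℂ}
    (hy : y ∈ IntermediateField.adjoin ℚ {z}) : ∃ p r : ℚ, y = p + r * z := by
  have hint : IsIntegral ℚ z := ⟨X ^ 2 - C d, by monicity!, by simp [hz]⟩
  rw [← IntermediateField.mem_toSubalgebra,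
    IntermediateField.adjoin_simple_toSubalgebra_of_isAlgebraic hint.isAlgebraic] at hy
  induction hy using Algebra.adjoin_induction with
  | mem w hw => exact ⟨0, 1, by rw [Set.mem_singleton_iff.1 hw]; simp⟩
  | algebraMap r => exact ⟨r, 0, by simp⟩
  | add a b _ _ ha hb =>
    obtain ⟨p, r, rfl⟩ := ha
    obtain ⟨p', r', rfl⟩ := hb
    exact ⟨p + p', r + r', by push_cast; ring⟩
  | mul a b _ _ ha hb =>
    obtain ⟨p, r, rfl⟩ := ha
    obtain ⟨p', r', rfl⟩ := hb
    exact ⟨p * p' + r * r' * d, p * r' + r * p', by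
      push_cast; linear_combination r * r' * hz⟩

lemma isTotallyRealNum_rat_add_mul {z : ℂ} {d : ℚ} (hd : 0 ≤ d) (hz : z ^ 2 = d) (p r : ℚ) :
    IsTotallyRealNum (p + r * z) := by
  have key : ∀ w : ℂ, aeval w ((X - C p) ^ 2 - C (r ^ 2 * d)) = (w - p) ^ 2 - r ^ 2 * d :=
    fun w ↦ by simp
  have h0 : aeval (p + r * z : ℂ) ((X - C p) ^ 2 - C (r ^ 2 * d)) = 0 := by
    rw [key]; linear_combination r ^ 2 * hz
  have hmonic : ((X - C p) ^ 2 - C (r ^ 2 * d)).Monic := by monicity!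
  refine ⟨⟨_, hmonic.ne_zero, h0⟩, fun w hw ↦ ?_⟩
  have h1 : (w - p) ^ 2 = ((r ^ 2 * d : ℚ) : ℂ) := by
    have h2 := aeval_eq_zero_of_dvd_aeval_eq_zero (minpoly.dvd ℚ _ h0) hw
    rw [key] at h2
    push_cast
    linear_combination h2
  have hre := congrArg Complex.re h1
  have him := congrArg Complex.im h1
  simp only [pow_two, Complex.mul_re, Complex.mul_im, Complex.sub_re, Complex.sub_im,
    Complex.ratCast_re, Complex.ratCast_im, sub_zero] at hre him
  have hnn : (0 : ℝ) ≤ ((r * r * d : ℚ) : ℝ) := by exact_mod_cast mul_nonneg (mul_self_nonneg r) hd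
  rw [hre.symm] at hnn
  have hab : (w.re - p) * w.im = 0 := by linarith
  rcases mul_eq_zero.1 hab with h | h
  · rw [h] at hnn; nlinarith
  · exact h

lemma mem_qtrDeg_of_sq_eq_ratCast {n : ℕ} (hn : 2 ≤ n) {z : ℂ} {d : ℚ} (hd : 0 ≤ d)
    (hz : z ^ 2 = d) : z ∈ QtrDeg n := by
  have hmonic : (X ^ 2 - C d : ℚ[X]).Monic := by monicity!
  have hroot : aeval z (X ^ 2 - C d : ℚ[X]) = 0 := by simp [hz]
  have hint : IsIntegral ℚ z := ⟨X ^ 2 - C d, hmonic, hroot⟩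
  have hfd := IntermediateField.adjoin.finiteDimensional hint
  have hdeg : Module.finrank ℚ ↥(IntermediateField.adjoin ℚ {z}) ≤ n := by
    rw [IntermediateField.adjoin.finrank hint]
    exact ((natDegree_le_of_dvd (minpoly.dvd ℚ z hroot) hmonic.ne_zero).trans
      (by compute_degree)).trans hn
  let e : ↥(IntermediateField.adjoin ℚ {z}) ≃ₗ[ℚ] ↥(IntermediateField.adjoin ℚ {z}).toSubfield :=
    { AddEquiv.refl ↥(IntermediateField.adjoin ℚ {z}) with
      map_smul' := map_rat_smul (AddMonoidHom.id ↥(IntermediateField.adjoin ℚ {z})) }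
  refine Subfield.subset_closure ⟨(IntermediateField.adjoin ℚ {z}).toSubfield, ?_, ?_, ?_,
    IntermediateField.mem_adjoin_simple_self ℚ z⟩
  · rintro ⟨y, hy⟩
    obtain ⟨p, r, rfl⟩ := exists_rat_add_mul_of_mem_adjoin hz hy
    exact isTotallyRealNum_rat_add_mul hd hz p r
  · exact Module.Finite.equiv e
  · exact e.finrank_eq ▸ hdeg

lemma exists_ringOfIntegers_sq_eq_intCast {n : ℕ} (hn : 2 ≤ n) {d : ℤ} (hd : 0 ≤ d) :
    ∃ a : 𝓞 ↥(QtrDeg n), a ^ 2 = d := by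
  obtain ⟨z, hz⟩ := IsAlgClosed.exists_pow_nat_eq (d : ℂ) (n := 2) (by norm_num)
  have hmem : z ∈ QtrDeg n :=
    mem_qtrDeg_of_sq_eq_ratCast hn (d := d) (by exact_mod_cast hd) (by rw [hz]; norm_cast)
  have hz' : (⟨z, hmem⟩ : ↥(QtrDeg n)) ^ 2 = (d : ↥(QtrDeg n)) := Subtype.ext (by simpa using hz)
  have hint : IsIntegral ℤ (⟨z, hmem⟩ : QtrDeg n) := by
    refine IsIntegral.of_pow (n := 2) (by norm_num) ?_
    rw [hz']; exact isIntegral_algebraMap (R := ℤ) (x := d)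
  obtain ⟨a, ha⟩ : ∃ a : 𝓞 ↥(QtrDeg n), algebraMap (𝓞 ↥(QtrDeg n)) ↥(QtrDeg n) a = ⟨z, hmem⟩ :=
    ⟨⟨_, hint⟩, rfl⟩
  exact ⟨a, RingOfIntegers.coe_injective (by rw [map_pow, map_intCast, ha, hz'])⟩

theorem not_exists_isUniversalForm_qtrDeg {n : ℕ} (h2 : 2 ≤ n) (h3 : n ≤ 3) :
    ¬ ∃ (m : ℕ) (Q : MvPolynomial (Fin m) (𝓞 ↥(QtrDeg n))), IsUniversalForm (QtrDeg n) Q := by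
  refine not_exists_isUniversalForm_of_le (qtrDeg_le_map_cubedCommutatorField h3) ?_ fun k hk ↦ ?_
  · obtain ⟨a, ha⟩ := exists_ringOfIntegers_sq_eq_intCast h2 (d := 2) (by norm_num)
    exact ⟨a, by rw [ha]; norm_num⟩
  · obtain ⟨a, ha⟩ := exists_ringOfIntegers_sq_eq_intCast h2 (d := 2 * k ^ 2 - 1) (by nlinarith)
    exact ⟨a, by rw [ha]; push_cast; rfl⟩

/-- Neither `ℚ^{tr,2}` nor `ℚ^{tr,3}` admits a universal quadratic form in any number of
variables. -/
theorem stmt_11 :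
    (¬ ∃ (n : ℕ) (Q : MvPolynomial (Fin n) (𝓞 ↥(QtrDeg 2))), IsUniversalForm (QtrDeg 2) Q) ∧
    (¬ ∃ (n : ℕ) (Q : MvPolynomial (Fin n) (𝓞 ↥(QtrDeg 3))), IsUniversalForm (QtrDeg 3) Q) := by
  exact ⟨not_exists_isUniversalForm_qtrDeg le_rfl (by norm_num),
    not_exists_isUniversalForm_qtrDeg (by norm_num) le_rfl⟩

end
end

section
/- There exists a strictly increasing sequence (q_i)_{i ≥ 1} of prime numbers such that q_i ≡ 3 (mod 4) for all i, and gcd(q_i − 1, q_j − 1) = 2 whenever i ≠ j. -/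
theorem Nat.exists_prime_gt_and_dvd_add_one (n : ℕ) {m : ℕ} (hm : m ≠ 0) :
    ∃ p > n, p.Prime ∧ m ∣ p + 1 := by
  obtain ⟨p, hpn, hp, hmod⟩ := Nat.forall_exists_prime_gt_and_zmodEq n (q := m) (a := -1) hm
    isCoprime_one_left.neg_left
  refine ⟨p, hpn, hp, ?_⟩
  have h := hmod.symm.dvd
  rw [sub_neg_eq_add] at h
  exact_mod_cast h

theorem Nat.gcd_sub_one_eq_two_of_dvd_add_one {p q : ℕ} (hp : p % 4 = 3) (hq : q % 4 = 3)
    (h : q - 1 ∣ p + 1) : Nat.gcd (q - 1) (p - 1) = 2 := by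
  apply Nat.dvd_antisymm
  · have hsub := Nat.dvd_sub ((Nat.gcd_dvd_left (q - 1) (p - 1)).trans h)
      (Nat.gcd_dvd_right (q - 1) (p - 1))
    rwa [show p + 1 - (p - 1) = 2 by omega] at hsub
  · exact Nat.dvd_gcd (by omega) (by omega)

/-- There is a strictly increasing sequence of primes `q i ≡ 3 (mod 4)` with
`gcd (q i − 1) (q j − 1) = 2` for `i ≠ j`. -/
theorem stmt_13 :
    ∃ q : ℕ → ℕ, StrictMono q ∧ (∀ i, Nat.Prime (q i) ∧ q i % 4 = 3) ∧
      ∀ i j, i ≠ j → Nat.gcd (q i - 1) (q j - 1) = 2 := by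
  obtain ⟨q, hq, hlt⟩ := exists_seq_of_forall_finset_exists
    (fun p : ℕ => p.Prime ∧ p % 4 = 3) (fun q p => q < p ∧ q - 1 ∣ p + 1) (by
      intro s hs
      have hm : 4 * ∏ x ∈ s, (x - 1) ≠ 0 :=
        mul_ne_zero four_ne_zero (Finset.prod_ne_zero_iff.2 fun x hx => by
          have := (hs x hx).2
          omega)
      obtain ⟨p, hgt, hp, hdvd⟩ := Nat.exists_prime_gt_and_dvd_add_one (s.sup id) hm
      have h4 : 4 ∣ p + 1 := (dvd_mul_right _ _).trans hdvd
      exact ⟨p, ⟨hp, by omega⟩, fun x hx => ⟨(Finset.le_sup (f := id) hx).trans_lt hgt,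
        ((Finset.dvd_prod_of_mem (fun x => x - 1) hx).trans (dvd_mul_left _ _)).trans hdvd⟩⟩)
  refine ⟨q, fun i j hij => (hlt i j hij).1, hq, fun i j hij => ?_⟩
  rcases lt_or_gt_of_ne hij with h | h
  · exact Nat.gcd_sub_one_eq_two_of_dvd_add_one (hq j).2 (hq i).2 (hlt i j h).2
  · rw [Nat.gcd_comm]
    exact Nat.gcd_sub_one_eq_two_of_dvd_add_one (hq i).2 (hq j).2 (hlt j i h).2
end

section
/- The set U = {K ∈ 𝒳 : the group O_K^{×,+}/O_K^{×2} is finite} is a meager subset of 𝒳 (with respect to the constructible topology). -/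
open Polynomial NumberField

set_option synthInstance.maxHeartbeats 400000
set_option maxHeartbeats 400000

noncomputable section

/-- `𝒳`: the space of all totally real fields, i.e. of all subfields of `ℚ^tr`, realized as
the subfields of `ℂ` all of whose elements are totally real algebraic numbers. -/
def TotallyRealFields : Type := {K : Subfield ℂ // ∀ x : ↥K, IsTotallyRealNum ↑x}

/-- The constructible topology on `𝒳`: the coarsest topology in which, for every totally real
algebraic number `a`, the set `{K ∈ 𝒳 | a ∈ K}` is both open and closed. -/
instance : TopologicalSpace TotallyRealFields :=
  TopologicalSpace.generateFrom
    {U : Set TotallyRealFields | ∃ a : ℂ, IsTotallyRealNum a ∧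
      (U = {K : TotallyRealFields | a ∈ K.1} ∨ U = {K : TotallyRealFields | a ∉ K.1})}

theorem exists_quadratic_subfield {L : Type*} [Field L] (F : Subfield L) (r : L) (hr : r ∉ F)
    (hr2 : r ^ 2 ∈ F) :
    ∃ F' : Subfield L, ∀ z, z ∈ F' ↔ ∃ u ∈ F, ∃ v ∈ F, z = u + v * r := by
  refine ⟨{ carrier := {z | ∃ u ∈ F, ∃ v ∈ F, z = u + v * r}
            mul_mem' := ?_, one_mem' := ?_, add_mem' := ?_, zero_mem' := ?_, neg_mem' := ?_,
            inv_mem' := ?_ }, fun z => Iff.rfl⟩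
  · rintro _ _ ⟨u, hu, v, hv, rfl⟩ ⟨u', hu', v', hv', rfl⟩
    exact ⟨u * u' + v * v' * r ^ 2,
      add_mem (mul_mem hu hu') (mul_mem (mul_mem hv hv') hr2), u * v' + v * u',
      add_mem (mul_mem hu hv') (mul_mem hv hu'), by ring⟩
  · exact ⟨1, one_mem F, 0, zero_mem F, by ring⟩
  · rintro _ _ ⟨u, hu, v, hv, rfl⟩ ⟨u', hu', v', hv', rfl⟩
    exact ⟨u + u', add_mem hu hu', v + v', add_mem hv hv', by ring⟩
  · exact ⟨0, zero_mem F, 0, zero_mem F, by ring⟩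
  · rintro _ ⟨u, hu, v, hv, rfl⟩
    exact ⟨-u, neg_mem hu, -v, neg_mem hv, by ring⟩
  · rintro _ ⟨u, hu, v, hv, rfl⟩
    by_cases hv0 : v = 0
    · subst hv0
      exact ⟨u⁻¹, inv_mem hu, 0, zero_mem F, by simp⟩
    have h1 : u + v * r ≠ 0 := fun h => hr <| by
      have : r = -u / v := by field_simp; linear_combination h
      rw [this]; exact div_mem (neg_mem hu) hv
    have h2 : u - v * r ≠ 0 := fun h => hr <| by
      have : r = u / v := by field_simp; linear_combination -h
      rw [this]; exact div_mem hu hv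
    have h3 : u ^ 2 - v ^ 2 * r ^ 2 ≠ 0 := by
      have := mul_ne_zero h1 h2
      intro h; apply this; linear_combination h
    have hN : u ^ 2 - v ^ 2 * r ^ 2 ∈ F :=
      sub_mem (pow_mem hu 2) (mul_mem (pow_mem hv 2) hr2)
    refine ⟨u / (u ^ 2 - v ^ 2 * r ^ 2), div_mem hu hN, -v / (u ^ 2 - v ^ 2 * r ^ 2),
      div_mem (neg_mem hv) hN, ?_⟩
    field_simp
    ring

theorem finite_primes_dividing_square_radicands (N : Type*) [Field N] [NumberField N] :
    {p : ℕ | p.Prime ∧ ∃ n : ℕ, Odd (padicValNat p n) ∧ ∃ s : N, s ^ 2 = n}.Finite := by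
  by_contra hinf
  have : Infinite ↥{p : ℕ | p.Prime ∧ ∃ n : ℕ, Odd (padicValNat p n) ∧ ∃ s : N, s ^ 2 = n} :=
    Set.infinite_coe_iff.mpr hinf
  choose hp n hodd s hs using fun
    p : ↥{p : ℕ | p.Prime ∧ ∃ n : ℕ, Odd (padicValNat p n) ∧ ∃ s : N, s ^ 2 = n} => p.2
  have : Finite (IntermediateField ℚ N) :=
    Field.finite_intermediateField_of_exists_primitive_element ℚ N
      (Field.exists_primitive_element ℚ N)
  have hn0 : ∀ p, n p ≠ 0 := fun p h => by simpa [h] using hodd p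
  have hirr : ∀ p, ∀ q : ℚ, q ^ 2 ≠ n p := fun p q hq => by
    have := Fact.mk (hp p)
    have h := congrArg (padicValRat p.1) hq
    rw [padicValRat.pow, padicValRat.of_nat] at h
    obtain ⟨k, hk⟩ := hodd p
    simp only [Nat.cast_ofNat] at h
    omega
  obtain ⟨E, hE⟩ := Finite.exists_infinite_fiber
    (fun p => IntermediateField.adjoin ℚ {s p})
  have hE' := Set.infinite_coe_iff.mp hE
  obtain ⟨p, hpE⟩ := hE'.nonempty
  obtain ⟨q, hqE, hqp⟩ : ∃ q, IntermediateField.adjoin ℚ {s q} = E ∧ n p < q.1 := by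
    by_contra! hcon
    refine hE' (Set.Finite.of_finite_image (f := Subtype.val) ?_ Subtype.val_injective.injOn)
    refine (Set.finite_Iic (n p)).subset ?_
    rintro _ ⟨q, hq, rfl⟩
    exact hcon q hq
  let Q : Subfield N := (algebraMap ℚ N).fieldRange
  have hsp : s p ∉ Q := by
    rintro ⟨a, ha⟩
    refine hirr p a ?_
    have := hs p
    rw [← ha] at this
    exact (algebraMap ℚ N).injective (by simpa using this)
  obtain ⟨F', hF'⟩ := exists_quadratic_subfield Q (s p) hsp ⟨n p, by simp [hs p]⟩
  have hmem : s q ∈ F' := by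
    have hle : IntermediateField.adjoin ℚ {s p} ≤
        F'.toIntermediateField (fun x => (hF' _).2 ⟨_, ⟨x, rfl⟩, 0, zero_mem Q, by simp⟩) :=
      IntermediateField.adjoin_le_iff.2 (by
        rintro _ rfl
        exact (hF' _).2 ⟨0, zero_mem Q, 1, one_mem Q, by simp⟩)
    apply hle
    have : s q ∈ IntermediateField.adjoin ℚ {s q} := IntermediateField.mem_adjoin_simple_self ℚ _
    rw [hqE, ← (show IntermediateField.adjoin ℚ {s p} = E from hpE)] at this
    exact this
  obtain ⟨_, ⟨a, rfl⟩, _, ⟨b, rfl⟩, hab⟩ := (hF' _).1 hmem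
  have hsq := hs q
  have hsp2 := hs p
  have key : (algebraMap ℚ N) (2 * a * b) * s p =
      algebraMap ℚ N (n q - a ^ 2 - b ^ 2 * n p) := by
    rw [hab] at hsq
    simp only [map_mul, map_sub, map_pow, map_ofNat, map_natCast]
    linear_combination hsq - (algebraMap ℚ N b) ^ 2 * hsp2
  by_cases hab0 : 2 * a * b = 0
  · rw [hab0, map_zero, zero_mul, eq_comm, map_eq_zero] at key
    rcases mul_eq_zero.1 hab0 with h | h
    · obtain rfl : a = 0 := by linarith
      have := Fact.mk (hp q)
      have hb : b ≠ 0 := by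
        rintro rfl
        apply hn0 q
        have : (n q : ℚ) = 0 := by linear_combination key
        exact_mod_cast this
      have h : (n q : ℚ) = b ^ 2 * n p := by linear_combination key
      have h := congrArg (padicValRat q.1) h
      rw [padicValRat.mul (pow_ne_zero _ hb) (by exact_mod_cast hn0 p), padicValRat.pow,
        padicValRat.of_nat, padicValRat.of_nat, padicValNat.eq_zero_of_not_dvd
        (fun hd => absurd (Nat.le_of_dvd (Nat.pos_of_ne_zero (hn0 p)) hd) (by omega))] at h
      obtain ⟨k, hk⟩ := hodd q
      simp only [Nat.cast_ofNat, Nat.cast_zero] at h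
      omega
    · subst h
      exact hirr q a (by linear_combination -key)
  · apply hsp
    refine ⟨(n q - a ^ 2 - b ^ 2 * n p) / (2 * a * b), ?_⟩
    rw [map_div₀, ← key]
    exact mul_div_cancel_left₀ _ (by simpa using hab0)

theorem exists_consecutive_nonsquares (N : Type*) [Field N] [NumberField N] :
    ∃ x : ℕ, ∀ s : N, s ^ 2 ≠ ((x + 1 : ℕ) : N) ∧ s ^ 2 ≠ (x : N) ∧
      s ^ 2 ≠ ((x * (x + 1) : ℕ) : N) := by
  have hfin := finite_primes_dividing_square_radicands N
  obtain ⟨p, ⟨hp, hpB⟩⟩ := (Nat.infinite_setOfPred_prime.sdiff hfin).nonempty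
  obtain ⟨q, ⟨⟨hq, hqB⟩, hqp⟩⟩ :=
    ((Nat.infinite_setOfPred_prime.sdiff hfin).sdiff (Set.finite_singleton p)).nonempty
  change p.Prime at hp
  change q.Prime at hq
  have hpB' : ∀ n : ℕ, Odd (padicValNat p n) → ∀ s : N, s ^ 2 ≠ n :=
    fun n hn s hs => hpB ⟨hp, n, hn, s, hs⟩
  have hqB' : ∀ n : ℕ, Odd (padicValNat q n) → ∀ s : N, s ^ 2 ≠ n :=
    fun n hn s hs => hqB ⟨hq, n, hn, s, hs⟩
  have hcop : Nat.Coprime (p ^ 2) (q ^ 2) :=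
    ((Nat.coprime_primes hp hq).2 (fun h => hqp h.symm)).pow 2 2
  have := Fact.mk hp
  have := Fact.mk hq
  obtain ⟨x, hx1, hx2⟩ := Nat.chineseRemainder hcop p (q ^ 2 + q - 1)
  have hq1 := hq.one_lt
  have hx2' : x + 1 ≡ q [MOD q ^ 2] := by
    have h := hx2.add_right 1
    rw [show q ^ 2 + q - 1 + 1 = q ^ 2 + q by omega] at h
    exact h.trans (by simp [Nat.ModEq])
  have val : ∀ {ℓ y : ℕ} (_ : Fact ℓ.Prime), y ≡ ℓ [MOD ℓ ^ 2] → padicValNat ℓ y = 1 := by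
    intro ℓ y hℓ h
    have h2 : ¬ ℓ ^ 2 ∣ ℓ := fun hd => by
      have := Nat.le_of_dvd hℓ.out.pos hd
      nlinarith [hℓ.out.one_lt]
    have h1 : ℓ ∣ y := (h.of_dvd (dvd_pow_self ℓ two_ne_zero)).dvd_iff dvd_rfl |>.2 dvd_rfl
    have h3 : ¬ ℓ ^ 2 ∣ y := fun hd => h2 ((h.dvd_iff dvd_rfl).1 hd)
    have hy : y ≠ 0 := by rintro rfl; simp at h3
    have := (padicValNat_dvd_iff_le hy (n := 1) (p := ℓ)).1 (by simpa using h1)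
    have := mt (padicValNat_dvd_iff_le hy (n := 2) (p := ℓ)).2 h3
    omega
  have hvp := val ‹_› hx1
  have hvq := val ‹_› hx2'
  have hx0 : x ≠ 0 := by rintro rfl; simp at hvp
  have hpx : p ∣ x := by
    by_contra h
    rw [padicValNat.eq_zero_of_not_dvd h] at hvp; omega
  refine ⟨x, fun s => ⟨hqB' _ (by simp [hvq]) s, hpB' _ (by simp [hvp]) s,
    hpB' _ ?_ s⟩⟩
  rw [padicValNat.mul hx0 (by omega), hvp, padicValNat.eq_zero_of_not_dvd]
  · simp
  · intro h
    have := (Nat.dvd_add_right hpx).1 h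
    exact hp.one_lt.ne' (Nat.dvd_one.1 this)

/-- The field `ℚ^tr` of totally real algebraic numbers. -/
def totallyRealNumbers : Subfield ℂ :=
  (⨅ σ : algebraicClosure ℚ ℂ →+* ℂ, Complex.ofRealHom.fieldRange.comap σ).map
    (algebraicClosure ℚ ℂ).val.toRingHom

theorem aeval_minpoly_eq_zero_iff_exists_algHom {k K : Type*} [Field k] [Field K] [Algebra k K]
    [IsAlgClosed K] (x : algebraicClosure k K) (w : K) :
    aeval w (minpoly k (x : K)) = 0 ↔ ∃ σ : algebraicClosure k K →ₐ[k] K, σ x = w := by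
  have h := Set.ext_iff.1 (Algebra.IsAlgebraic.range_eval_eq_rootSet_minpoly
    (F := k) (K := algebraicClosure k K) K x) w
  rw [mem_rootSet_of_ne (minpoly.ne_zero (Algebra.IsIntegral.isIntegral x))] at h
  rw [← IntermediateField.minpoly_eq, ← h]
  rfl

theorem aeval_minpoly_eq_zero_iff (x : algebraicClosure ℚ ℂ) (w : ℂ) :
    aeval w (minpoly ℚ (x : ℂ)) = 0 ↔ ∃ σ : algebraicClosure ℚ ℂ →+* ℂ, σ x = w := by
  rw [aeval_minpoly_eq_zero_iff_exists_algHom]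
  exact ⟨fun ⟨σ, h⟩ => ⟨σ.toRingHom, h⟩, fun ⟨σ, h⟩ => ⟨σ.toRatAlgHom, h⟩⟩

theorem mem_totallyRealNumbers_iff (z : ℂ) : z ∈ totallyRealNumbers ↔ IsTotallyRealNum z := by
  constructor
  · rintro ⟨x, hx, rfl⟩
    refine ⟨mem_algebraicClosure_iff.1 x.2, fun w hw => ?_⟩
    obtain ⟨σ, rfl⟩ := (aeval_minpoly_eq_zero_iff x w).1 hw
    have hx' := (Subfield.mem_iInf.1 hx) σ
    obtain ⟨r, hr⟩ := hx'
    have hr' : (r : ℂ) = σ x := hr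
    rw [← hr']
    exact Complex.ofReal_im r
  · rintro ⟨hz, h⟩
    refine ⟨⟨z, mem_algebraicClosure_iff.2 hz⟩, Subfield.mem_iInf.2 fun σ => ?_, rfl⟩
    refine ⟨(σ ⟨z, mem_algebraicClosure_iff.2 hz⟩).re, ?_⟩
    have := h _ ((aeval_minpoly_eq_zero_iff ⟨z, mem_algebraicClosure_iff.2 hz⟩ _).2 ⟨σ, rfl⟩)
    exact Complex.ext rfl (by simpa using this.symm)

theorem isTotallyRealNum_of_sq_eq_natCast {s : ℂ} {x : ℕ} (hs : s ^ 2 = x) :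
    IsTotallyRealNum s := by
  have hzint : IsAlgebraic ℚ s := by
    refine IsAlgebraic.of_pow two_pos ?_
    rw [hs]
    exact isAlgebraic_natCast x
  refine ⟨hzint, fun w hw => ?_⟩
  have hdvd : minpoly ℚ s ∣ X ^ 2 - C (x : ℚ) := minpoly.dvd _ _ (by simp [hs])
  have h0 := aeval_eq_zero_of_dvd_aeval_eq_zero hdvd hw
  have hw2 : w ^ 2 = x := by simpa [sub_eq_zero] using h0
  have hre := congrArg Complex.re hw2
  have him := congrArg Complex.im hw2
  simp only [pow_two, Complex.mul_re, Complex.mul_im, Complex.natCast_re,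
    Complex.natCast_im] at hre him
  by_contra h
  have : w.re = 0 := by
    have : w.re * w.im = 0 := by linarith
    exact (mul_eq_zero.1 this).resolve_right h
  rw [this] at hre
  have hx : (0 : ℝ) ≤ x := Nat.cast_nonneg x
  have := sq_pos_of_ne_zero h
  nlinarith

theorem isTotallyPositive_sq {z : ℂ} (hz : IsTotallyRealNum z) (h0 : z ≠ 0) :
    IsTotallyPositive (z ^ 2) := by
  refine ⟨hz.1.pow 2, fun w hw => ?_⟩
  let x : algebraicClosure ℚ ℂ := ⟨z, mem_algebraicClosure_iff.2 hz.1⟩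
  obtain ⟨σ, rfl⟩ := (aeval_minpoly_eq_zero_iff (x ^ 2) w).1 hw
  have him := hz.2 (σ x) ((aeval_minpoly_eq_zero_iff x _).2 ⟨σ, rfl⟩)
  have hx : x ≠ 0 := fun h => h0 (congrArg Subtype.val h)
  have hσ : σ x ≠ 0 := (map_ne_zero σ).2 hx
  have hre : (σ x).re ≠ 0 := fun h => hσ (Complex.ext h him)
  rw [map_pow, pow_two, Complex.mul_re, Complex.mul_im, him]
  refine ⟨?_, by ring⟩
  have := sq_pos_of_ne_zero hre
  nlinarith

/-- `g` is a totally real unit of the ring of algebraic integers. -/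
def IsTotallyRealUnit (g : ℂ) : Prop :=
  IsTotallyRealNum g ∧ g ≠ 0 ∧ IsIntegral ℤ g ∧ IsIntegral ℤ g⁻¹

/-- `G` is a set of square roots of totally positive units of `K` that lie in pairwise distinct
square classes of `K`. -/
def AreIndependentRoots (G : Finset ℂ) (K : Subfield ℂ) : Prop :=
  (∀ g ∈ G, IsTotallyRealUnit g ∧ g ^ 2 ∈ K) ∧ ∀ g ∈ G, ∀ h ∈ G, g ≠ h → g * h ∉ K

theorem exists_quadratic_extension_with_new_unit (S : Finset ℂ) (hS : ∀ s ∈ S, IsAlgebraic ℚ s)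
    (F : Subfield ℂ) (hFS : F ≤ (IntermediateField.adjoin ℚ (S : Set ℂ)).toSubfield)
    (hF : F ≤ totallyRealNumbers) (B C : Finset ℂ) (hB : ∀ b ∈ B, IsAlgebraic ℚ b)
    (hBF : ∀ b ∈ B, b ∉ F) (hC : ∀ c ∈ C, IsAlgebraic ℚ c ∧ c ≠ 0) :
    ∃ (r g : ℂ) (F' : Subfield ℂ), IsAlgebraic ℚ r ∧ F ≤ F' ∧
      F' ≤ (IntermediateField.adjoin ℚ ((insert r S : Finset ℂ) : Set ℂ)).toSubfield ∧
      F' ≤ totallyRealNumbers ∧ (∀ b ∈ B, b ∉ F') ∧ IsTotallyRealUnit g ∧ g ^ 2 ∈ F' ∧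
      ∀ c ∈ C, c * g ∉ F' := by
  classical
  let N := IntermediateField.adjoin ℚ ((S ∪ B ∪ C : Finset ℂ) : Set ℂ)
  have hsub : ∀ z ∈ S ∪ B ∪ C, z ∈ N := fun z hz => IntermediateField.subset_adjoin ℚ _ hz
  have : FiniteDimensional ℚ N := by
    refine IntermediateField.finiteDimensional_adjoin fun z hz => ?_
    simp only [Finset.coe_union, Set.mem_union, Finset.mem_coe] at hz
    rcases hz with (hz | hz) | hz
    exacts [(hS z hz).isIntegral, (hB z hz).isIntegral, (hC z hz).1.isIntegral]
  have : NumberField N := { }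
  have hFN : F ≤ N.toSubfield := fun z hz =>
    IntermediateField.adjoin.mono ℚ _ _ (by simp) (hFS hz)
  obtain ⟨x, hx⟩ := exists_consecutive_nonsquares N
  have hxN : ∀ z ∈ N, z ^ 2 ≠ ((x + 1 : ℕ) : ℂ) ∧ z ^ 2 ≠ (x : ℂ) ∧
      z ^ 2 ≠ ((x * (x + 1) : ℕ) : ℂ) := fun z hz =>
    ⟨fun h => (hx ⟨z, hz⟩).1 (Subtype.ext (by simpa using h)),
     fun h => (hx ⟨z, hz⟩).2.1 (Subtype.ext (by simpa using h)),
     fun h => (hx ⟨z, hz⟩).2.2 (Subtype.ext (by simpa using h))⟩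
  obtain ⟨s, hs⟩ := IsAlgClosed.exists_pow_nat_eq ((x + 1 : ℕ) : ℂ) two_pos
  obtain ⟨t, ht⟩ := IsAlgClosed.exists_pow_nat_eq (x : ℂ) two_pos
  have hrsq : (s * t) ^ 2 = ((x * (x + 1) : ℕ) : ℂ) := by
    rw [mul_pow, hs, ht]; push_cast; ring
  have hsT := (mem_totallyRealNumbers_iff s).2 (isTotallyRealNum_of_sq_eq_natCast hs)
  have htT := (mem_totallyRealNumbers_iff t).2 (isTotallyRealNum_of_sq_eq_natCast ht)
  have hsN : s ∉ N := fun h => (hxN s h).1 hs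
  have htN : t ∉ N := fun h => (hxN t h).2.1 ht
  have hrN : s * t ∉ N := fun h => (hxN _ h).2.2 hrsq
  have hrF : s * t ∉ F := fun h => hrN (hFN h)
  have hst : (s + t) * (s - t) = 1 := by
    push_cast at hs
    linear_combination hs - ht
  have hginv : (s + t)⁻¹ = s - t := inv_eq_of_mul_eq_one_right hst
  have hrF2 : (s * t) ^ 2 ∈ F := by rw [hrsq]; exact natCast_mem F _
  have hsI : IsIntegral ℤ s := IsIntegral.of_pow two_pos (by rw [hs]; exact isIntegral_natCast _)
  have htI : IsIntegral ℤ t := IsIntegral.of_pow two_pos (by rw [ht]; exact isIntegral_natCast _)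
  obtain ⟨F', hF'⟩ := exists_quadratic_subfield F (s * t) hrF hrF2
  refine ⟨s * t, s + t, F', ((mem_totallyRealNumbers_iff _).1 (mul_mem hsT htT)).1,
    fun u hu => (hF' u).2 ⟨u, hu, 0, zero_mem F, by ring⟩, ?_, ?_, ?_,
    ⟨(mem_totallyRealNumbers_iff _).1 (add_mem hsT htT), left_ne_zero_of_mul_eq_one hst,
      hsI.add htI, hginv ▸ hsI.sub htI⟩, ?_, ?_⟩
  · intro z hz
    obtain ⟨u, hu, v, hv, rfl⟩ := (hF' z).1 hz
    have hle : F ≤ (IntermediateField.adjoin ℚ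
        ((insert (s * t) S : Finset ℂ) : Set ℂ)).toSubfield :=
      fun z hz => IntermediateField.adjoin.mono ℚ _ _ (by simp) (hFS hz)
    exact add_mem (hle hu) (mul_mem (hle hv) (IntermediateField.subset_adjoin ℚ _ (by simp)))
  · intro z hz
    obtain ⟨u, hu, v, hv, rfl⟩ := (hF' z).1 hz
    exact add_mem (hF hu) (mul_mem (hF hv) (mul_mem hsT htT))
  · intro b hb hbF'
    obtain ⟨u, hu, v, hv, huv⟩ := (hF' b).1 hbF'
    by_cases hv0 : v = 0
    · exact hBF b hb (by rw [huv, hv0]; simpa using hu)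
    · refine hrN ?_
      rw [show s * t = (b - u) / v by rw [huv]; field_simp; ring]
      exact div_mem (sub_mem (hsub b (by simp [hb])) (hFN hu)) (hFN hv)
  · refine (hF' _).2 ⟨((x + 1 : ℕ) : ℂ) + x, add_mem (natCast_mem F _) (natCast_mem F _), 2,
      ofNat_mem F 2, ?_⟩
    rw [← hs, ← ht]; ring
  · intro c hc hcF'
    obtain ⟨u, hu, v, hv, huv⟩ := (hF' _).1 hcF'
    have hcN : c ∈ N := hsub c (by simp [hc])
    have hc0 := (hC c hc).2
    obtain ⟨a, ha, b, hb, hab⟩ : ∃ a ∈ N, ∃ b ∈ N, s + t = a + b * (s * t) :=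
      ⟨u / c, div_mem (hFN hu) hcN, v / c, div_mem (hFN hv) hcN, by
        field_simp; linear_combination huv⟩
    have hs2 : s ^ 2 ∈ N := by rw [hs]; exact natCast_mem N _
    have ht2 : t ^ 2 ∈ N := by rw [ht]; exact natCast_mem N _
    -- squaring `s + t = a + b s t` expresses `(2 - 2ab) s t` in `N`
    have h1 : 1 - a * b = 0 := by
      by_contra h
      refine hrN ?_
      have h' : (2 : ℂ) - 2 * (a * b) ≠ 0 := fun h2 => h (by linear_combination h2 / 2)
      rw [show s * t = (a ^ 2 + b ^ 2 * (s ^ 2 * t ^ 2) - s ^ 2 - t ^ 2) / (2 - 2 * (a * b)) by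
        rw [eq_div_iff h']
        linear_combination (s + t + a + b * (s * t)) * hab]
      exact div_mem (sub_mem (sub_mem (add_mem (pow_mem ha 2)
        (mul_mem (pow_mem hb 2) (mul_mem hs2 ht2))) hs2) ht2)
        (sub_mem (ofNat_mem N 2) (mul_mem (ofNat_mem N 2) (mul_mem ha hb)))
    have h2 : (1 - b * s) * (1 - b * t) = 0 := by
      linear_combination (-b) * hab + h1
    have hb0 : b ≠ 0 := by rintro rfl; simp at h1
    rcases mul_eq_zero.1 h2 with h | h
    · refine hsN ?_
      rw [show s = b⁻¹ by field_simp; linear_combination -h]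
      exact inv_mem hb
    · refine htN ?_
      rw [show t = b⁻¹ by field_simp; linear_combination -h]
      exact inv_mem hb

theorem exists_independentRoots_card_eq (A B : Finset ℂ) (K : TotallyRealFields)
    (hA : ∀ a ∈ A, a ∈ K.1) (hB : ∀ b ∈ B, IsAlgebraic ℚ b ∧ b ∉ K.1) (n : ℕ) :
    ∃ (S : Finset ℂ) (F : Subfield ℂ), (∀ s ∈ S, IsAlgebraic ℚ s) ∧
      F ≤ (IntermediateField.adjoin ℚ (S : Set ℂ)).toSubfield ∧ F ≤ totallyRealNumbers ∧
      (∀ a ∈ A, a ∈ F) ∧ (∀ b ∈ B, b ∉ F) ∧ ∃ G : Finset ℂ, G.card = n ∧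
        AreIndependentRoots G F := by
  classical
  induction n with
  | zero =>
    have hle : Subfield.closure (A : Set ℂ) ≤ K.1 := Subfield.closure_le.2 hA
    refine ⟨A, Subfield.closure (A : Set ℂ), fun s hs => (K.2 ⟨s, hA s hs⟩).1,
      Subfield.closure_le.2 (IntermediateField.subset_adjoin ℚ _),
      fun z hz => (mem_totallyRealNumbers_iff z).2 (K.2 ⟨z, hle hz⟩),
      fun a ha => Subfield.subset_closure ha, fun b hb h => (hB b hb).2 (hle h), ∅, rfl, ?_⟩
    simp [AreIndependentRoots]
  | succ n ih =>
    obtain ⟨S, F, hS, hFS, hF, hAF, hBF, G, hGn, hG, hGG⟩ := ih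
    have hGa : ∀ g ∈ G, IsAlgebraic ℚ g := fun g hg => (hG g hg).1.1.1
    obtain ⟨r, g, F', hr, hFF', hF'S, hF', hB', hg, hgF', hcg⟩ :=
      exists_quadratic_extension_with_new_unit S hS F hFS hF
        (B ∪ (G.offDiag.image fun p => p.1 * p.2)) G
        (fun b hb => by
          simp only [Finset.mem_union, Finset.mem_image, Finset.mem_offDiag] at hb
          rcases hb with hb | ⟨p, ⟨h1, h2, -⟩, rfl⟩
          · exact (hB b hb).1
          · exact (hGa _ h1).mul (hGa _ h2))
        (fun b hb => by
          simp only [Finset.mem_union, Finset.mem_image, Finset.mem_offDiag] at hb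
          rcases hb with hb | ⟨p, ⟨h1, h2, h3⟩, rfl⟩
          · exact hBF b hb
          · exact hGG _ h1 _ h2 h3)
        (fun c hc => ⟨hGa c hc, (hG c hc).1.2.1⟩)
    have hgG : g ∉ G := fun h => hcg g h (by rwa [← pow_two])
    refine ⟨insert r S, F', ?_, hF'S, hF', fun a ha => hFF' (hAF a ha),
      fun b hb => hB' b (by simp [hb]), insert g G, by rw [Finset.card_insert_of_notMem hgG, hGn],
      ?_, ?_⟩
    · intro s hs
      rcases Finset.mem_insert.1 hs with rfl | hs
      exacts [hr, hS s hs]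
    · intro h hh
      rcases Finset.mem_insert.1 hh with rfl | hh
      exacts [⟨hg, hgF'⟩, ⟨(hG h hh).1, hFF' (hG h hh).2⟩]
    · intro h hh k hk hne
      rcases Finset.mem_insert.1 hh with rfl | hh <;> rcases Finset.mem_insert.1 hk with rfl | hk
      · exact absurd rfl hne
      · rw [mul_comm]; exact hcg k hk
      · exact hcg h ‹_›
      · refine hB' _ (Finset.mem_union_right _ (Finset.mem_image.2 ⟨(h, k), ?_, rfl⟩))
        exact Finset.mem_offDiag.2 ⟨hh, hk, hne⟩

theorem isOpen_setOf_mem {a : ℂ} (ha : IsTotallyRealNum a) :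
    IsOpen {K : TotallyRealFields | a ∈ K.1} :=
  TopologicalSpace.isOpen_generateFrom_of_mem ⟨a, ha, Or.inl rfl⟩

theorem isOpen_setOf_notMem {a : ℂ} (ha : IsTotallyRealNum a) :
    IsOpen {K : TotallyRealFields | a ∉ K.1} :=
  TopologicalSpace.isOpen_generateFrom_of_mem ⟨a, ha, Or.inr rfl⟩

theorem IsTotallyRealNum.mul {a b : ℂ} (ha : IsTotallyRealNum a) (hb : IsTotallyRealNum b) :
    IsTotallyRealNum (a * b) := by
  rw [← mem_totallyRealNumbers_iff] at *
  exact mul_mem ha hb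

theorem isOpen_setOf_areIndependentRoots (n : ℕ) :
    IsOpen {K : TotallyRealFields | ∃ G : Finset ℂ, G.card = n ∧ AreIndependentRoots G K.1} := by
  have h : {K : TotallyRealFields | ∃ G : Finset ℂ, G.card = n ∧ AreIndependentRoots G K.1} =
      ⋃ (G : Finset ℂ) (_ : G.card = n ∧ ∀ g ∈ G, IsTotallyRealUnit g),
        (⋂ g ∈ G, {K : TotallyRealFields | g ^ 2 ∈ K.1}) ∩
        ⋂ g ∈ G, ⋂ h ∈ G, ⋂ (_ : g ≠ h), {K : TotallyRealFields | g * h ∉ K.1} := by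
    ext K
    simp only [AreIndependentRoots, Set.mem_ofPred_eq, Set.mem_iUnion, Set.mem_inter_iff,
      Set.mem_iInter, exists_prop]
    grind
  rw [h]
  refine isOpen_iUnion fun G => isOpen_iUnion fun hG => IsOpen.inter ?_ ?_
  · refine isOpen_biInter_finset fun g hg => isOpen_setOf_mem ?_
    rw [pow_two]
    exact (hG.2 g hg).1.mul (hG.2 g hg).1
  · refine isOpen_biInter_finset fun g hg => isOpen_biInter_finset fun h hh => ?_
    refine isOpen_iInter_of_finite fun _ => isOpen_setOf_notMem ?_
    exact (hG.2 g hg).1.mul (hG.2 h hh).1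

theorem exists_finset_subset_of_mem_isOpen {U : Set TotallyRealFields} (hU : IsOpen U)
    {K : TotallyRealFields} (hK : K ∈ U) :
    ∃ A B : Finset ℂ, (∀ a ∈ A, a ∈ K.1) ∧ (∀ b ∈ B, IsAlgebraic ℚ b ∧ b ∉ K.1) ∧
      ∀ L : TotallyRealFields, (∀ a ∈ A, a ∈ L.1) → (∀ b ∈ B, b ∉ L.1) → L ∈ U := by
  classical
  induction hU with
  | basic V hV =>
    obtain ⟨a, ha, rfl | rfl⟩ := hV
    · exact ⟨{a}, ∅, by simpa using hK, by simp, fun L hL _ => hL a (by simp)⟩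
    · exact ⟨∅, {a}, by simp, by simpa using ⟨ha.1, hK⟩, fun L _ hL => hL a (by simp)⟩
  | univ => exact ⟨∅, ∅, by simp, by simp, fun _ _ _ => trivial⟩
  | inter V W _ _ ihV ihW =>
    obtain ⟨A, B, hA, hB, h⟩ := ihV hK.1
    obtain ⟨A', B', hA', hB', h'⟩ := ihW hK.2
    refine ⟨A ∪ A', B ∪ B', ?_, ?_, fun L hL hL' => ⟨h L ?_ ?_, h' L ?_ ?_⟩⟩ <;> grind
  | sUnion S _ ih =>
    obtain ⟨V, hV, hKV⟩ := hK
    obtain ⟨A, B, hA, hB, h⟩ := ih V hV hKV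
    exact ⟨A, B, hA, hB, fun L hL hL' => ⟨V, hV, h L hL hL'⟩⟩

theorem dense_setOf_areIndependentRoots (n : ℕ) :
    Dense {K : TotallyRealFields | ∃ G : Finset ℂ, G.card = n ∧ AreIndependentRoots G K.1} := by
  rw [dense_iff_inter_open]
  rintro U hU ⟨K, hK⟩
  obtain ⟨A, B, hA, hB, h⟩ := exists_finset_subset_of_mem_isOpen hU hK
  obtain ⟨-, F, -, -, hF, hAF, hBF, hG⟩ := exists_independentRoots_card_eq A B K hA hB n
  exact ⟨⟨F, fun x => (mem_totallyRealNumbers_iff _).1 (hF x.2)⟩, h _ hAF hBF, hG⟩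

theorem card_le_of_areIndependentRoots {K : Subfield ℂ} {G : Finset ℂ}
    (hG : AreIndependentRoots G K) {S : Finset (𝓞 ↥K)}
    (hS : ∀ ε : 𝓞 ↥K, IsUnit ε → IsTotallyPositive ((ε : ↥K) : ℂ) →
      ∃ c ∈ S, ∃ u : 𝓞 ↥K, IsUnit u ∧ ε = c * u ^ 2) : G.card ≤ S.card := by
  have hcls : ∀ g ∈ G, ∃ c ∈ S, ∃ u : 𝓞 ↥K, g ^ 2 = ((c : K) : ℂ) * ((u : K) : ℂ) ^ 2 := by
    intro g hg
    obtain ⟨⟨hgT, hg0, hgI, hgI'⟩, hgK⟩ := hG.1 g hg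
    have hzint : ∀ z : K, IsIntegral ℤ (z : ℂ) → IsIntegral ℤ z := fun z hz =>
      (isIntegral_algHom_iff (K.subtype.toIntAlgHom) Subtype.val_injective).1 hz
    let ε : 𝓞 ↥K := ⟨⟨g ^ 2, hgK⟩, hzint _ (hgI.pow 2)⟩
    let η : 𝓞 ↥K := ⟨⟨g⁻¹ ^ 2, by rw [inv_pow]; exact inv_mem hgK⟩, hzint _ (hgI'.pow 2)⟩
    have hε : ε * η = 1 := by
      apply RingOfIntegers.ext
      apply Subtype.ext
      change g ^ 2 * g⁻¹ ^ 2 = 1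
      field_simp
    obtain ⟨c, hc, u, -, h⟩ := hS ε (IsUnit.of_mul_eq_one η hε) (isTotallyPositive_sq hgT hg0)
    refine ⟨c, hc, u, ?_⟩
    calc g ^ 2 = (((c * u ^ 2 : 𝓞 ↥K) : K) : ℂ) := congrArg (fun z : 𝓞 ↥K => ((z : K) : ℂ)) h
      _ = ((c : K) : ℂ) * ((u : K) : ℂ) ^ 2 := by simp
  choose! c hc u hu using hcls
  refine Finset.card_le_card_of_injOn c hc fun g hg h hh hgh => ?_
  by_contra hne
  refine hG.2 g hg h hh hne ?_
  have hsq : (g * h) ^ 2 = (((c g * u g * u h : 𝓞 ↥K) : K) : ℂ) ^ 2 := by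
    rw [mul_pow, hu g hg, hu h hh, ← hgh]
    push_cast
    ring
  rcases sq_eq_sq_iff_eq_or_eq_neg.1 hsq with h' | h'
  · rw [h']; exact Subtype.property _
  · rw [h']; exact neg_mem (Subtype.property _)

/-- The set of totally real fields `K` for which the group `𝓞_K^{×,+}/𝓞_K^{×2}` is finite
(i.e. finitely many totally positive units represent all square classes of totally positive
units) is meager in `𝒳` with the constructible topology. -/
theorem stmt_16 :
    IsMeagre {K : TotallyRealFields | ∃ S : Finset (𝓞 ↥K.1),
      ∀ ε : 𝓞 ↥K.1, IsUnit ε → IsTotallyPositive ((ε : ↥K.1) : ℂ) →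
        ∃ c ∈ S, ∃ u : 𝓞 ↥K.1, IsUnit u ∧ ε = c * u ^ 2} := by
  have h : ∀ n : ℕ, {K : TotallyRealFields |
      ∃ G : Finset ℂ, G.card = n ∧ AreIndependentRoots G K.1} ∈ residual TotallyRealFields :=
    fun n => residual_of_dense_open (isOpen_setOf_areIndependentRoots n)
      (dense_setOf_areIndependentRoots n)
  refine Filter.mem_of_superset (countable_iInter_mem.2 h) ?_
  rintro K hK ⟨S, hS⟩
  obtain ⟨G, hGn, hG⟩ := Set.mem_iInter.1 hK (S.card + 1)
  have := card_le_of_areIndependentRoots hG hS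
  omega

end
end

section
/- The set U' = {K ∈ 𝒳 : there exists a universal quadratic lattice over K} is a meager subset of 𝒳 (with respect to the constructible topology). -/
open Polynomial NumberField

set_option synthInstance.maxHeartbeats 400000
set_option maxHeartbeats 400000

noncomputable section

/-- A quadratic lattice over a field `K` (with ring of integers `R = 𝓞 K`): a torsion-free
finitely generated `R`-module together with an `R`-valued quadratic map on it. -/
structure QuadLattice (R : Type) [CommRing R] : Type 1 where
  carrier : Type
  [acg : AddCommGroup carrier]
  [mod : Module R carrier]
  finite : Module.Finite R carrier
  torsionFree : NoZeroSMulDivisors R carrier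
  form : QuadraticMap R carrier R

attribute [instance] QuadLattice.acg QuadLattice.mod

/-- A quadratic lattice over `K` is universal if it is positive definite and represents every
totally positive element of `𝓞_K`. -/
def QuadLattice.IsUniversal (K : Subfield ℂ) (Λ : QuadLattice (𝓞 ↥K)) : Prop :=
  (∀ v : Λ.carrier, v ≠ 0 → IsTotallyPositive ((Λ.form v : ↥K) : ℂ)) ∧
  (∀ α : 𝓞 ↥K, IsTotallyPositive ((α : ↥K) : ℂ) → ∃ v : Λ.carrier, Λ.form v = α)

section ReflectionStable

variable {R Λ : Type*} [CommRing R] [AddCommGroup Λ] [Module R Λ]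
  {q : QuadraticMap R Λ R} {ρ : R →+* ℝ}

lemma QuadraticMap.polar_self_pos (hpos : ∀ v, v ≠ 0 → 0 < ρ (q v)) {v : Λ} (hv : v ≠ 0) :
    0 < ρ (QuadraticMap.polar q v v) := by
  have := hpos v hv
  rw [QuadraticMap.polar_self]
  rw [two_nsmul, map_add]
  linarith

lemma QuadraticMap.eq_zero_of_polar_eq_zero {ι : Type*} (hpos : ∀ v, v ≠ 0 → 0 < ρ (q v))
    {e : ι → Λ} (he : Submodule.span R (Set.range e) = ⊤) {x : Λ}
    (hx : ∀ k, QuadraticMap.polar q x (e k) = 0) : x = 0 := by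
  have h1 : ∀ y ∈ Submodule.span R (Set.range e), QuadraticMap.polar q x y = 0 := by
    intro y hy
    induction hy using Submodule.span_induction with
    | mem y hy =>
      obtain ⟨k, rfl⟩ := hy
      exact hx k
    | zero => simp
    | add a b _ _ ha hb => rw [QuadraticMap.polar_add_right, ha, hb, add_zero]
    | smul r a _ ha => rw [QuadraticMap.polar_smul_right, ha, smul_zero]
  by_contra h
  have h2 := QuadraticMap.polar_self_pos hpos h
  rw [h1 x (he ▸ Submodule.mem_top), map_zero] at h2
  exact lt_irrefl _ h2

/-- The identity behind the Cauchy–Schwarz inequality. -/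
lemma QuadraticMap.map_two_mul_smul_sub_polar_smul (x y : Λ) :
    q ((2 * q x) • y - QuadraticMap.polar q x y • x) =
      q x * (4 * q x * q y - QuadraticMap.polar q x y ^ 2) := by
  have h := QuadraticMap.map_add q ((2 * q x) • y) (-(QuadraticMap.polar q x y • x))
  rw [← sub_eq_add_neg] at h
  rw [h, QuadraticMap.map_neg, QuadraticMap.map_smul, QuadraticMap.map_smul,
    QuadraticMap.polar_neg_right, QuadraticMap.polar_smul_left, QuadraticMap.polar_smul_right,
    QuadraticMap.polar_comm q y x]
  simp only [smul_eq_mul]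
  ring

lemma QuadraticMap.polar_sq_le (hpos : ∀ v, v ≠ 0 → 0 < ρ (q v)) (x y : Λ) :
    ρ (QuadraticMap.polar q x y) ^ 2 ≤ 4 * ρ (q x) * ρ (q y) := by
  rcases eq_or_ne x 0 with rfl | hx
  · simp
  have h0 : 0 ≤ ρ (q ((2 * q x) • y - QuadraticMap.polar q x y • x)) := by
    rcases eq_or_ne ((2 * q x) • y - QuadraticMap.polar q x y • x) 0 with h | h
    · simp [h]
    · exact (hpos _ h).le
  rw [QuadraticMap.map_two_mul_smul_sub_polar_smul, map_mul] at h0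
  have := nonneg_of_mul_nonneg_right h0 (hpos x hx)
  simp only [map_sub, map_mul, map_pow, map_ofNat] at this
  linarith

/-- Pairwise obtuse vectors in an open half-space are linearly independent. -/
lemma QuadraticMap.linearIndependent_of_obtuse {ι : Type*} [Fintype ι]
    (hρ : Function.Injective ρ) (hpos : ∀ v, v ≠ 0 → 0 < ρ (q v)) (f : Λ →+ ℝ)
    (hf : ∀ r x, f (r • x) = ρ r * f x) (v : ι → Λ) (hfv : ∀ i, 0 < f (v i))
    (hv : ∀ i j, i ≠ j → ρ (QuadraticMap.polar q (v i) (v j)) ≤ 0) :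
    LinearIndependent R v := by
  classical
  rw [Fintype.linearIndependent_iff]
  intro g hg
  set w := ∑ i with 0 < ρ (g i), g i • v i with hw
  set w' := ∑ i with ¬ 0 < ρ (g i), g i • v i with hw'
  have hsum : w + w' = 0 := by rw [hw, hw', Finset.sum_filter_add_sum_filter_not, hg]
  have h1 : 0 ≤ ρ (QuadraticMap.polar q w w') := by
    have : QuadraticMap.polar q w w' = ∑ i with 0 < ρ (g i), ∑ j with ¬ 0 < ρ (g j),
        g i * g j * QuadraticMap.polar q (v i) (v j) := by
      change q.polarBilin w w' = _
      simp only [hw, hw', map_sum, LinearMap.sum_apply, map_smul, LinearMap.smul_apply,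
        QuadraticMap.polarBilin_apply_apply, smul_eq_mul]
      rw [Finset.sum_comm]
      refine Finset.sum_congr rfl fun i _ => ?_
      rw [Finset.mul_sum]
      exact Finset.sum_congr rfl fun j _ => by ring
    rw [this, map_sum]
    refine Finset.sum_nonneg fun i hi => ?_
    rw [map_sum]
    refine Finset.sum_nonneg fun j hj => ?_
    simp only [Finset.mem_filter, Finset.mem_univ, true_and, not_lt] at hi hj
    have hij : i ≠ j := by rintro rfl; linarith
    rw [map_mul, map_mul]
    exact mul_nonneg_of_nonpos_of_nonpos (mul_nonpos_of_nonneg_of_nonpos hi.le hj) (hv i j hij)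
  have hw0 : w = 0 := by
    by_contra hne
    have h2 := QuadraticMap.polar_self_pos hpos hne
    rw [eq_neg_of_add_eq_zero_right hsum, QuadraticMap.polar_neg_right, map_neg] at h1
    linarith
  have hw0' : w' = 0 := by simpa [hw0] using hsum
  have hfs : ∀ s : Finset ι, f (∑ i ∈ s, g i • v i) = ∑ i ∈ s, ρ (g i) * f (v i) := by
    intro s; simp [map_sum, hf]
  have e1 := hfs (Finset.univ.filter fun i => 0 < ρ (g i))
  have e2 := hfs (Finset.univ.filter fun i => ¬ 0 < ρ (g i))
  rw [← hw, hw0, map_zero, eq_comm, Finset.sum_eq_zero_iff_of_nonneg] at e1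
  · rw [← hw', hw0', map_zero, eq_comm, Finset.sum_eq_zero_iff_of_nonpos] at e2
    · intro i
      have : ρ (g i) * f (v i) = 0 := by
        by_cases h : 0 < ρ (g i)
        · exact e1 i (by simp [h])
        · exact e2 i (by simpa using h)
      have := (mul_eq_zero.mp this).resolve_right (hfv i).ne'
      exact hρ (by simpa using this)
    · intro i hi
      simp only [Finset.mem_filter, Finset.mem_univ, true_and, not_lt] at hi
      exact mul_nonpos_of_nonpos_of_nonneg hi (hfv i).le
  · intro i hi
    simp only [Finset.mem_filter, Finset.mem_univ, true_and] at hi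
    exact mul_nonneg hi.le (hfv i).le

/-- Finite sets `Φ i` of vectors of unit norm `ε i`, jointly stable under reflections and with
the `ε i` in distinct square classes, are no more than the number of generators of the lattice:
picking the lowest positive vector of every `Φ i` gives an obtuse family. -/
theorem QuadraticMap.card_le_of_reflection_stable {ι : Type*} [Fintype ι] {n : ℕ}
    [Nontrivial R]
    (hρ : Function.Injective ρ) (hpos : ∀ v, v ≠ 0 → 0 < ρ (q v))
    (e : Fin n → Λ) (he : Submodule.span R (Set.range e) = ⊤) (ε : ι → Rˣ)
    (hε : ∀ i j, i ≠ j → ∀ s : R, s ^ 2 ≠ 4 * (ε i * ε j)) (Φ : ι → Set Λ)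
    (hfin : ∀ i, (Φ i).Finite) (hne : ∀ i, (Φ i).Nonempty) (hq : ∀ i, ∀ x ∈ Φ i, q x = ε i)
    (hrefl : ∀ i j, ∀ x ∈ Φ i, ∀ y ∈ Φ j,
      x - ((ε j)⁻¹ * QuadraticMap.polar q x y) • y ∈ Φ i) :
    Fintype.card ι ≤ n := by
  classical
  have hΦ0 : ∀ i, ∀ x ∈ Φ i, x ≠ 0 := by
    rintro i x hx rfl
    have := hq i 0 hx
    rw [QuadraticMap.map_zero] at this
    exact (ε i).ne_zero this.symm
  have hεpos : ∀ i, 0 < ρ (ε i) := fun i => by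
    obtain ⟨x, hx⟩ := hne i
    rw [← hq i x hx]
    exact hpos x (hΦ0 i x hx)
  have hneg : ∀ i, ∀ x ∈ Φ i, -x ∈ Φ i := by
    intro i x hx
    have := hrefl i i x hx x hx
    rw [QuadraticMap.polar_self, hq i x hx] at this
    convert this using 1
    rw [mul_smul_comm, Units.inv_mul, ← Nat.cast_smul_eq_nsmul R, smul_eq_mul, mul_one,
      Nat.cast_ofNat, two_smul]
    abel
  -- a functional that does not vanish on the `Φ i`
  let T : Λ → (Fin n → ℝ) := fun x k => ρ (QuadraticMap.polar q x (e k))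
  have hT0 : ∀ x, x ≠ 0 → T x ≠ 0 := by
    intro x hx h
    exact hx (QuadraticMap.eq_zero_of_polar_eq_zero hpos he fun k =>
      hρ (by simpa [T] using congrFun h k))
  have hU : (⋃ i, Φ i).Finite := Set.finite_iUnion hfin
  have := hU.to_subtype
  obtain ⟨g, hg⟩ := Module.exists_dual_forall_apply_ne_zero (K := ℝ)
    (fun x : (⋃ i, Φ i) => T x.1) (fun x => by
      obtain ⟨i, hi⟩ := Set.mem_iUnion.mp x.2
      exact hT0 _ (hΦ0 i _ hi))
  let f : Λ →+ ℝ :=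
    { toFun := fun x => g (T x)
      map_zero' := by
        have : T 0 = 0 := by ext k; simp [T]
        rw [this, map_zero]
      map_add' := fun x y => by
        have : T (x + y) = T x + T y := by ext k; simp [T, QuadraticMap.polar_add_left]
        rw [this, map_add] }
  have hf : ∀ r x, f (r • x) = ρ r * f x := fun r x => by
    have : T (r • x) = ρ r • T x := by ext k; simp [T, QuadraticMap.polar_smul_left]
    change g (T (r • x)) = ρ r * g (T x)
    rw [this, map_smul, smul_eq_mul]
  have hf0 : ∀ i, ∀ x ∈ Φ i, f x ≠ 0 := fun i x hx => hg ⟨x, Set.mem_iUnion.mpr ⟨i, hx⟩⟩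
  have hmin : ∀ i, ∃ v ∈ Φ i, 0 < f v ∧ ∀ x ∈ Φ i, 0 < f x → f v ≤ f x := by
    intro i
    obtain ⟨v, hv, hv'⟩ := Set.exists_min_image {x ∈ Φ i | 0 < f x} f
      ((hfin i).subset (Set.sep_subset _ _)) (by
        obtain ⟨x, hx⟩ := hne i
        rcases lt_or_gt_of_ne (hf0 i x hx) with h | h
        · exact ⟨-x, hneg i x hx, by rw [map_neg]; linarith⟩
        · exact ⟨x, hx, h⟩)
    exact ⟨v, hv.1, hv.2, fun x hx hx' => hv' x ⟨hx, hx'⟩⟩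
  choose v hvΦ hvpos hvmin using hmin
  have key : ∀ i j, i ≠ j → 0 < ρ (QuadraticMap.polar q (v i) (v j)) →
      2 * f (v i) * ρ (ε j) ≤ ρ (QuadraticMap.polar q (v i) (v j)) * f (v j) := by
    intro i j hij hp
    set c := ρ (QuadraticMap.polar q (v i) (v j))
    have h1 := hrefl i j _ (hvΦ i) _ (hvΦ j)
    have hinv : ρ ((ε j)⁻¹ : Rˣ) * ρ (ε j) = 1 := by rw [← map_mul]; simp
    have hd : 0 < ρ ((ε j)⁻¹ : Rˣ) := pos_of_mul_pos_left (hinv ▸ one_pos) (hεpos j).le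
    have hfx := map_sub f (v i) (((ε j)⁻¹ * QuadraticMap.polar q (v i) (v j)) • v j)
    rw [hf, map_mul] at hfx
    set y := v i - (((ε j)⁻¹ : Rˣ) * QuadraticMap.polar q (v i) (v j)) • v j
    set d := ρ ((ε j)⁻¹ : Rˣ)
    have hlow : f y < f (v i) := by
      have := mul_pos (mul_pos hd hp) (hvpos j)
      linarith
    have hyneg : f y < 0 := by
      rcases lt_or_gt_of_ne (hf0 i y h1) with h | h
      · exact h
      · exact absurd (hvmin i y h1 h) (not_le.mpr hlow)
    have := hvmin i (-y) (hneg i y h1) (by rw [map_neg]; linarith)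
    rw [map_neg, hfx] at this
    have h2 : 2 * f (v i) ≤ d * c * f (v j) := by linarith
    calc 2 * f (v i) * ρ (ε j) ≤ d * c * f (v j) * ρ (ε j) :=
          mul_le_mul_of_nonneg_right h2 (hεpos j).le
      _ = d * ρ (ε j) * (c * f (v j)) := by ring
      _ = c * f (v j) := by rw [hinv, one_mul]
  have hobt : ∀ i j, i ≠ j → ρ (QuadraticMap.polar q (v i) (v j)) ≤ 0 := by
    intro i j hij
    by_contra! hp
    have k1 := key i j hij hp
    have k2 := key j i hij.symm (by rwa [QuadraticMap.polar_comm])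
    rw [QuadraticMap.polar_comm q (v j)] at k2
    have cs := QuadraticMap.polar_sq_le hpos (v i) (v j)
    rw [hq i _ (hvΦ i), hq j _ (hvΦ j)] at cs
    set c := ρ (QuadraticMap.polar q (v i) (v j)) with hc
    have hm : (2 * f (v i) * ρ (ε j)) * (2 * f (v j) * ρ (ε i)) ≤ (c * f (v j)) * (c * f (v i)) :=
      mul_le_mul k1 k2 (by have := hvpos j; have := hεpos i; positivity)
        (mul_pos hp (hvpos j)).le
    have hm' : (4 * ρ (ε i) * ρ (ε j)) * (f (v i) * f (v j)) ≤ c ^ 2 * (f (v i) * f (v j)) := by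
      linarith
    have hge := le_of_mul_le_mul_right hm' (mul_pos (hvpos i) (hvpos j))
    refine hε i j hij (QuadraticMap.polar q (v i) (v j)) (hρ ?_)
    simp only [map_pow, map_mul, map_ofNat]
    linarith
  have hli := QuadraticMap.linearIndependent_of_obtuse hρ hpos f hf v hvpos hobt
  have h := linearIndependent_le_span v hli (Set.range e) he
  rw [Cardinal.mk_fintype, Nat.cast_le] at h
  exact h.trans ((Fintype.card_range_le e).trans_eq (Fintype.card_fin n))

end ReflectionStable

lemma padicValRat_even_sq (p : ℕ) [Fact p.Prime] (a : ℚ) : Even (padicValRat p (a ^ 2)) := by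
  rcases eq_or_ne a 0 with rfl | h
  · simp
  · rw [padicValRat.pow]; exact even_two_mul _

lemma mem_adjoin_sq {K S : Type*} [Field K] [Field S] [Algebra K S] {s : S} {m : K}
    (hs : s ^ 2 = algebraMap K S m) {x : S} (hx : x ∈ IntermediateField.adjoin K {s}) :
    ∃ a b : K, x = algebraMap K S a + algebraMap K S b * s := by
  have hint : IsIntegral K s := ⟨X ^ 2 - C m, monic_X_pow_sub_C m two_ne_zero, by simp [hs]⟩
  rw [← IntermediateField.mem_toSubalgebra,
    IntermediateField.adjoin_simple_toSubalgebra_of_isAlgebraic hint.isAlgebraic] at hx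
  induction hx using Algebra.adjoin_induction with
  | mem x hx => exact ⟨0, 1, by simpa using hx⟩
  | algebraMap r => exact ⟨r, 0, by simp⟩
  | add x y _ _ hx hy =>
    obtain ⟨a, b, rfl⟩ := hx
    obtain ⟨c, d, rfl⟩ := hy
    exact ⟨a + c, b + d, by simp only [map_add]; ring⟩
  | mul x y _ _ hx hy =>
    obtain ⟨a, b, rfl⟩ := hx
    obtain ⟨c, d, rfl⟩ := hy
    refine ⟨a * c + b * d * m, a * d + b * c, ?_⟩
    simp only [map_add, map_mul]
    linear_combination (algebraMap K S b * algebraMap K S d) * hs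

/-- In a number field, only finitely many primes can divide a rational number that is a square
there to an odd power. -/
lemma finite_primes_odd_sq (S : Type*) [Field S] [CharZero S] [Algebra ℚ S]
    [FiniteDimensional ℚ S] :
    {p : ℕ | p.Prime ∧ ∃ (m : ℚ) (s : S), Odd (padicValRat p m) ∧
      s ^ 2 = algebraMap ℚ S m}.Finite := by
  by_contra hinf
  have := Set.Infinite.to_subtype hinf
  have hfin : Finite (IntermediateField ℚ S) :=
    (Field.exists_primitive_element_iff_finite_intermediateField ℚ S).mp
      ⟨inferInstance, Field.exists_primitive_element ℚ S⟩
  choose hp m s hm hs using fun p : {p : ℕ | p.Prime ∧ ∃ (m : ℚ) (s : S),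
    Odd (padicValRat p m) ∧ s ^ 2 = algebraMap ℚ S m} => p.2
  obtain ⟨k, hk⟩ := Finite.exists_infinite_fiber (fun p => IntermediateField.adjoin ℚ {s p})
  obtain ⟨p₀, hp₀⟩ := hk.nonempty
  have hinj : Function.Injective (algebraMap ℚ S) := (algebraMap ℚ S).injective
  have hm0 : m p₀ ≠ 0 := by
    intro h
    have := hm p₀
    simp [h] at this
  have hodd : ∀ p, IntermediateField.adjoin ℚ {s p} = k → Odd (padicValRat p (m p₀)) := by
    intro p hpk
    have := Fact.mk (hp p)
    have hmem : s p ∈ IntermediateField.adjoin ℚ {s p₀} := by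
      rw [show IntermediateField.adjoin ℚ {s p₀} = IntermediateField.adjoin ℚ {s p} from
        (show _ = k from hp₀).trans hpk.symm]
      exact IntermediateField.mem_adjoin_simple_self ℚ _
    obtain ⟨a, b, hab⟩ := mem_adjoin_sq (hs p₀) hmem
    have hsq : algebraMap ℚ S (m p) = algebraMap ℚ S (a ^ 2 + b ^ 2 * m p₀) +
        algebraMap ℚ S (2 * a * b) * s p₀ := by
      rw [← hs p, hab]
      simp only [map_add, map_mul, map_pow, map_ofNat]
      linear_combination (algebraMap ℚ S b) ^ 2 * hs p₀
    rcases eq_or_ne b 0 with rfl | hb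
    · exfalso
      have : m p = a ^ 2 := hinj (by rw [hsq]; simp)
      have h1 := hm p
      rw [this] at h1
      exact Int.not_even_iff_odd.mpr h1 (padicValRat_even_sq p a)
    rcases eq_or_ne a 0 with rfl | ha
    · have h2 : m p = b ^ 2 * m p₀ := hinj (by rw [hsq]; simp)
      have h1 := hm p
      rw [h2, padicValRat.mul (pow_ne_zero 2 hb) hm0] at h1
      rw [add_comm] at h1
      exact Int.odd_add.mp h1 |>.mpr (padicValRat_even_sq p b)
    · exfalso
      have hab2 : (2 * a * b : ℚ) ≠ 0 := by positivity
      have hr : s p₀ = algebraMap ℚ S ((m p - (a ^ 2 + b ^ 2 * m p₀)) / (2 * a * b)) := by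
        rw [map_div₀, eq_div_iff ((_root_.map_ne_zero _).mpr hab2), map_sub, hsq]
        ring
      have h0 := hs p₀
      rw [hr, ← map_pow] at h0
      have h1 := hm p₀
      rw [← hinj h0] at h1
      have := Fact.mk (hp p₀)
      exact Int.not_even_iff_odd.mpr h1 (padicValRat_even_sq p₀ _)
  have hdvd : Set.Infinite {p : ℕ | p.Prime ∧ padicValRat p (m p₀) ≠ 0} := by
    have := (Set.infinite_coe_iff.mp hk).image (f := Subtype.val) Subtype.val_injective.injOn
    refine this.mono ?_
    rintro _ ⟨p, hpk, rfl⟩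
    refine ⟨hp p, fun h => ?_⟩
    have := hodd p hpk
    rw [h] at this
    simp at this
  refine hdvd (((m p₀).num.natAbs.primeFactors ∪ (m p₀).den.primeFactors).finite_toSet.subset ?_)
  rintro p ⟨hpp, hv⟩
  by_contra hnot
  have hnum : (m p₀).num.natAbs ≠ 0 := by simpa using hm0
  simp only [Finset.coe_union, Set.mem_union, Finset.mem_coe, Nat.mem_primeFactors, not_or,
    not_and, hpp, true_implies, hnum, (m p₀).den_nz, ne_eq, not_false_eq_true,
    imp_false, not_true] at hnot
  apply hv
  rw [padicValRat, padicValInt, padicValNat.eq_zero_of_not_dvd (fun h => hnot.1 h),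
    padicValNat.eq_zero_of_not_dvd (fun h => hnot.2 h)]
  simp

lemma exists_nat_not_sq (S : Type*) [Field S] [CharZero S] [Algebra ℚ S]
    [FiniteDimensional ℚ S] :
    ∃ t : ℕ, 3 ≤ t ∧ ∀ s : S, s ^ 2 ≠ t + 2 ∧ s ^ 2 ≠ t - 2 ∧ s ^ 2 ≠ t ^ 2 - 4 := by
  have hF := finite_primes_odd_sq S
  have hinf := (Nat.infinite_setOfPred_prime.sdiff (hF.union (Set.finite_Iic 4)))
  obtain ⟨p, ⟨hp, hp'⟩⟩ := hinf.nonempty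
  obtain ⟨r, ⟨⟨hr, hr'⟩, hrp⟩⟩ := (hinf.sdiff (Set.finite_singleton p)).nonempty
  simp only [Set.mem_union, Set.mem_Iic, not_or, not_le, Set.mem_ofPred_eq,
    Set.mem_singleton_iff] at hp hr hp' hr' hrp
  have key : ∀ q : ℕ, q.Prime → ¬ (q.Prime ∧ ∃ (m : ℚ) (s : S), Odd (padicValRat q m) ∧
      s ^ 2 = algebraMap ℚ S m) → ∀ (u w : ℕ) (s : S), ¬ q ∣ u → w ≠ 0 → w % q ^ 2 = q →
      s ^ 2 ≠ ((u * w : ℕ) : S) := by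
    intro q hq hnot u w s hu hw0 hw hs
    have := Fact.mk hq
    refine hnot ⟨hq, ((u * w : ℕ) : ℚ), s, ?_, by simpa using hs⟩
    have hu0 : u ≠ 0 := by rintro rfl; simp at hu
    rw [padicValRat.of_nat, padicValNat.mul hu0 hw0, padicValNat.eq_zero_of_not_dvd hu]
    have h1 : padicValNat q w = 1 := by
      have hd : w = q * (1 + q * (w / q ^ 2)) := by
        conv_lhs => rw [← Nat.mod_add_div w (q ^ 2), hw]
        ring
      have hnd : ¬ q ∣ (1 + q * (w / q ^ 2)) := by
        rw [Nat.dvd_add_left (Dvd.intro _ rfl)]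
        exact hq.one_lt.ne' ∘ Nat.dvd_one.mp
      rw [hd, padicValNat.mul hq.ne_zero (by omega), padicValNat.self hq.one_lt,
        padicValNat.eq_zero_of_not_dvd hnd]
    simp [h1]
  have hcop : Nat.Coprime (p ^ 2) (r ^ 2) :=
    Nat.Coprime.pow 2 2 ((Nat.coprime_primes hp hr).mpr (Ne.symm hrp))
  -- `w = t - 2`
  obtain ⟨w, hw1, hw2⟩ := Nat.chineseRemainder hcop p (r ^ 2 + r - 4)
  have hpp : p < p ^ 2 := by nlinarith [hp'.2]
  have hrr : r < r ^ 2 := by nlinarith [hr'.2]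
  have hwp : w % p ^ 2 = p := by rw [hw1]; exact Nat.mod_eq_of_lt hpp
  have hwr : (w + 4) % r ^ 2 = r := by
    have h2 : (w + 4) % r ^ 2 = (r ^ 2 + r - 4 + 4) % r ^ 2 := hw2.add_right 4
    rw [h2, Nat.sub_add_cancel (by omega), Nat.add_mod_left, Nat.mod_eq_of_lt hrr]
  have hw0 : w ≠ 0 := by
    rintro rfl
    simp at hwp
    omega
  have hpw : p ∣ w := by
    rw [← Nat.mod_add_div w (p ^ 2), hwp, pow_two, mul_assoc]
    exact dvd_add dvd_rfl (Dvd.intro _ rfl)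
  refine ⟨w + 2, by omega, fun s => ⟨fun h => ?_, fun h => ?_, fun h => ?_⟩⟩
  · refine key r hr hr'.1 1 (w + 4) s (hr.one_lt.ne' ∘ Nat.dvd_one.mp) (by omega) hwr ?_
    rw [h]; push_cast; ring
  · refine key p hp hp'.1 1 w s (hp.one_lt.ne' ∘ Nat.dvd_one.mp) hw0 hwp ?_
    rw [h]; push_cast; ring
  · refine key p hp hp'.1 (w + 4) w s ?_ hw0 hwp ?_
    · rw [Nat.dvd_add_right hpw]
      intro h4
      exact absurd (Nat.le_of_dvd (by norm_num) h4) (by omega)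
    · rw [h]; push_cast; ring
lemma IsTotallyPositive.isTotallyRealNum {z : ℂ} (h : IsTotallyPositive z) : IsTotallyRealNum z :=
  ⟨h.1, fun w hw => (h.2 w hw).2⟩

lemma isTotallyRealNum_of_mem_adjoin {A : Set ℂ} (hA : ∀ a ∈ A, IsTotallyRealNum a) {x : ℂ}
    (hx : x ∈ IntermediateField.adjoin ℚ A) : IsTotallyRealNum x := by
  have halg : Algebra.IsAlgebraic ℚ (IntermediateField.adjoin ℚ A) :=
    IntermediateField.isAlgebraic_adjoin fun a ha => (hA a ha).1.isIntegral
  have hroot : ∀ (y : IntermediateField.adjoin ℚ A) (φ : IntermediateField.adjoin ℚ A →ₐ[ℚ] ℂ),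
      aeval (φ y) (minpoly ℚ (y : ℂ)) = 0 := fun y φ => by
    rw [← IntermediateField.minpoly_eq, aeval_algHom_apply]
    exact (congrArg φ (minpoly.aeval ℚ y)).trans (map_zero φ)
  refine ⟨IntermediateField.isAlgebraic_iff.mp (halg.isAlgebraic ⟨x, hx⟩), fun w hw => ?_⟩
  have hwr : w ∈ (minpoly ℚ (⟨x, hx⟩ : IntermediateField.adjoin ℚ A)).rootSet ℂ := by
    rw [mem_rootSet]
    refine ⟨minpoly.ne_zero (halg.isAlgebraic _).isIntegral, ?_⟩
    exact (congrArg (aeval w) (IntermediateField.minpoly_eq _)).trans hw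
  rw [← Algebra.IsAlgebraic.range_eval_eq_rootSet_minpoly ℂ] at hwr
  obtain ⟨φ, rfl⟩ := hwr
  clear hw
  induction hx using IntermediateField.adjoin_induction with
  | mem a ha =>
    exact (hA a ha).2 _ (hroot ⟨a, IntermediateField.subset_adjoin ℚ A ha⟩ φ)
  | algebraMap r =>
    have := φ.commutes r
    change (φ (algebraMap ℚ _ r)).im = 0
    rw [this]
    simp
  | add a b ha hb iha ihb =>
    have := map_add φ ⟨a, ha⟩ ⟨b, hb⟩
    change (φ (⟨a, ha⟩ + ⟨b, hb⟩)).im = 0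
    simp_all
  | inv a ha iha =>
    change (φ (⟨a, ha⟩⁻¹)).im = 0
    simp_all
  | mul a b ha hb iha ihb =>
    change (φ (⟨a, ha⟩ * ⟨b, hb⟩)).im = 0
    rw [map_mul, Complex.mul_im, iha, ihb]
    ring

lemma isTotallyPositive_of_sq_add_one {t : ℕ} (ht : 3 ≤ t) {ε : ℂ} (hε : ε ^ 2 + 1 = t * ε) :
    IsTotallyPositive ε := by
  have hm : (X ^ 2 - C (t : ℚ) * X + 1 : ℚ[X]).Monic := by monicity!
  have h0 : aeval ε (X ^ 2 - C (t : ℚ) * X + 1 : ℚ[X]) = 0 := by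
    simp
    linear_combination hε
  refine ⟨⟨_, hm.ne_zero, h0⟩, fun w hw => ?_⟩
  have hw2 : w ^ 2 - t * w + 1 = 0 := by
    have := aeval_eq_zero_of_dvd_aeval_eq_zero (minpoly.dvd ℚ ε h0) hw
    simpa using this
  have ht' : (3 : ℝ) ≤ t := by exact_mod_cast ht
  have hre := congrArg Complex.re hw2
  have him := congrArg Complex.im hw2
  simp [pow_two] at hre him
  have him' : w.im * (2 * w.re - t) = 0 := by linarith
  rcases mul_eq_zero.mp him' with h | h
  · refine ⟨?_, h⟩
    rw [h] at hre
    nlinarith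
  · nlinarith [sq_nonneg w.im]

lemma isIntegral_of_sq_add_one {A : Type*} [CommRing A] {t : ℕ} {ε : A} (hε : ε ^ 2 + 1 = t * ε) :
    IsIntegral ℤ ε :=
  ⟨X ^ 2 - C (t : ℤ) * X + 1, by monicity!, by
    simp
    linear_combination hε⟩

lemma exists_unit_adjoin (k S : IntermediateField ℚ ℂ) [FiniteDimensional ℚ S] (hkS : k ≤ S) :
    ∃ (ε : ℂ) (t : ℕ), 3 ≤ t ∧ ε ^ 2 + 1 = t * ε ∧
      (∀ x ∈ IntermediateField.adjoin k {ε}, x ∈ S → x ∈ k) ∧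
      ∀ e ∈ k, e ≠ 0 → ∀ r ∈ S, r ^ 2 = e →
        ∀ s ∈ IntermediateField.adjoin k {ε}, s ^ 2 ≠ ε * e := by
  obtain ⟨t, ht, hts⟩ := exists_nat_not_sq S
  have hS : ∀ s ∈ S, s ^ 2 ≠ t + 2 ∧ s ^ 2 ≠ t - 2 ∧ s ^ 2 ≠ t ^ 2 - 4 := by
    intro s hs
    obtain ⟨h1, h2, h3⟩ := hts ⟨s, hs⟩
    refine ⟨fun h => h1 (S.val.injective ?_), fun h => h2 (S.val.injective ?_),
      fun h => h3 (S.val.injective ?_)⟩ <;>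
    simp only [map_pow, map_add, map_sub, map_natCast, map_ofNat] <;> exact h
  obtain ⟨δ, hδ⟩ := IsAlgClosed.exists_pow_nat_eq ((t : ℂ) ^ 2 - 4) (n := 2) (by norm_num)
  have hδS : δ ∉ S := fun h => (hS δ h).2.2 hδ
  set ε : ℂ := (t + δ) / 2 with hεdef
  have hε : ε ^ 2 + 1 = t * ε := by
    rw [hεdef]
    linear_combination hδ / 4
  have hε0 : ε ≠ 0 := by
    rintro h
    simp [h] at hε
  have htk : (t : ℂ) ∈ k := natCast_mem k t
  have hD : (t : ℂ) ^ 2 - 4 ∈ k := sub_mem (pow_mem htk 2) (ofNat_mem k 4)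
  have hle : ∀ x ∈ IntermediateField.adjoin k {ε},
      ∃ a ∈ k, ∃ b ∈ k, x = a + b * δ := by
    intro x hx
    have h1 : IntermediateField.adjoin k {ε} ≤ IntermediateField.adjoin k {δ} := by
      rw [IntermediateField.adjoin_simple_le_iff, hεdef]
      refine div_mem (add_mem (natCast_mem _ t) (IntermediateField.mem_adjoin_simple_self k δ))
        (ofNat_mem _ 2)
    obtain ⟨a, b, h⟩ := mem_adjoin_sq (K := k) (m := ⟨_, hD⟩) hδ (h1 hx)
    exact ⟨a, a.2, b, b.2, h⟩
  have hnot : ∀ a ∈ k, ∀ b ∈ k, ∀ x ∈ S, x = a + b * δ → b = 0 := by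
    intro a ha b hb x hx h
    by_contra hb0
    apply hδS
    have : δ = (x - a) / b := by rw [h]; field_simp; ring
    rw [this]
    exact div_mem (sub_mem hx (hkS ha)) (hkS hb)
  refine ⟨ε, t, ht, hε, fun x hx hxS => ?_, fun e he he0 r hr hre s hs hse => ?_⟩
  · obtain ⟨a, ha, b, hb, h⟩ := hle x hx
    rw [h, hnot a ha b hb x hxS h]
    simpa using ha
  · have hu : s * (t + 2 + δ) / (2 * ε) ∈ IntermediateField.adjoin k {ε} := by
      have hεm := IntermediateField.mem_adjoin_simple_self k ε
      have : δ = 2 * ε - t := by rw [hεdef]; ring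
      rw [this]
      exact div_mem (mul_mem hs (add_mem (add_mem (natCast_mem _ t) (ofNat_mem _ 2))
        (sub_mem (mul_mem (ofNat_mem _ 2) hεm) (natCast_mem _ t)))) (mul_mem (ofNat_mem _ 2) hεm)
    obtain ⟨a, ha, b, hb, h⟩ := hle _ hu
    have h2 : (a + b * δ) ^ 2 = (t + 2) * e := by
      rw [← h, div_pow, mul_pow, hse, div_eq_iff (pow_ne_zero 2 (mul_ne_zero two_ne_zero hε0))]
      rw [hεdef]
      linear_combination (t + δ) / 2 * e * hδ
    have hr0 : r ≠ 0 := by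
      rintro rfl
      exact he0 (by simpa using hre.symm)
    have hab : 2 * a * b = 0 := by
      refine hnot (a ^ 2 + b ^ 2 * (t ^ 2 - 4)) ?_ _ ?_ ((t + 2) * e) ?_ ?_
      · exact add_mem (pow_mem ha 2) (mul_mem (pow_mem hb 2) hD)
      · exact mul_mem (mul_mem (ofNat_mem k 2) ha) hb
      · exact hkS (mul_mem (add_mem htk (ofNat_mem k 2)) he)
      · linear_combination -h2 + b ^ 2 * hδ
    have hab' : a = 0 ∨ b = 0 := by simpa using hab
    rcases hab' with rfl | rfl
    · have ht2 : (t : ℂ) + 2 ≠ 0 := by exact_mod_cast (by omega : t + 2 ≠ 0)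
      have h3 : b ^ 2 * (t - 2) = e := by
        apply mul_left_cancel₀ ht2
        linear_combination h2 - b ^ 2 * hδ
      have hb0 : b ≠ 0 := by
        rintro rfl
        exact he0 (by simpa using h3.symm)
      refine (hS (r / b) (div_mem hr (hkS hb))).2.1 ?_
      rw [div_pow, hre, ← h3]
      field_simp
    · refine (hS (a / r) (div_mem (hkS ha) hr)).1 ?_
      rw [div_pow, hre, div_eq_iff he0]
      linear_combination h2

lemma exists_units_adjoin (m : ℕ) (k S : IntermediateField ℚ ℂ) [FiniteDimensional ℚ S]
    (hkS : k ≤ S) :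
    ∃ (k' : IntermediateField ℚ ℂ) (E : Finset ℂ), E.card = m ∧ FiniteDimensional ℚ k' ∧ k ≤ k' ∧
      k' ≤ IntermediateField.adjoin ℚ (k ∪ E : Set ℂ) ∧ (∀ x ∈ k', x ∈ S → x ∈ k) ∧
      (∀ ε ∈ E, ε ∈ k' ∧ ∃ t : ℕ, 3 ≤ t ∧ ε ^ 2 + 1 = t * ε) ∧
      ∀ ε ∈ E, ∀ e ∈ E, ε ≠ e → ∀ s ∈ k', s ^ 2 ≠ ε * e := by
  classical
  induction m with
  | zero =>
    have : FiniteDimensional ℚ k :=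
      FiniteDimensional.of_injective (IntermediateField.inclusion hkS).toLinearMap
        (IntermediateField.inclusion hkS).injective
    exact ⟨k, ∅, rfl, this, le_rfl, fun x hx => IntermediateField.subset_adjoin ℚ _ (Or.inl hx),
      fun x hx _ => hx, by simp, by simp⟩
  | succ m ih =>
    obtain ⟨k₁, E, hcard, hfin, hkk₁, hk₁, hdisj, hE, hsq⟩ := ih
    choose r hr using fun z : ℂ => IsAlgClosed.exists_pow_nat_eq z (n := 2) (by norm_num)
    have hE0 : ∀ e ∈ E, e ≠ 0 := by
      rintro e he rfl
      obtain ⟨t, -, h⟩ := (hE 0 he).2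
      simp at h
    have hRfin : FiniteDimensional ℚ (IntermediateField.adjoin ℚ (r '' E)) := by
      have : Finite (r '' (E : Set ℂ)) := (E.finite_toSet.image r).to_subtype
      refine IntermediateField.finiteDimensional_adjoin ?_
      rintro _ ⟨e, he, rfl⟩
      obtain ⟨t, ht, h⟩ := (hE e he).2
      have := (isTotallyPositive_of_sq_add_one ht h).1.isIntegral
      rw [← hr e] at this
      exact this.of_pow (by norm_num)
    obtain ⟨ε, t, ht, hε, hd, hs⟩ := exists_unit_adjoin k₁
      (S ⊔ k₁ ⊔ IntermediateField.adjoin ℚ (r '' E)) (le_sup_right.trans le_sup_left)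
    set k₂ := (IntermediateField.adjoin k₁ {ε}).restrictScalars ℚ
    have hle : k₁ ≤ k₂ := fun x hx =>
      (IntermediateField.adjoin k₁ {ε}).algebraMap_mem (⟨x, hx⟩ : k₁)
    have hεk : ε ∈ k₂ := IntermediateField.mem_adjoin_simple_self k₁ ε
    have hεE : ∀ e ∈ E, ∀ s ∈ k₂, s ^ 2 ≠ ε * e := fun e he s hsk =>
      hs e (hE e he).1 (hE0 e he) (r e) (le_sup_right (a := S ⊔ k₁)
        (IntermediateField.subset_adjoin ℚ _ ⟨e, he, rfl⟩)) (hr e) s hsk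
    have hεnE : ε ∉ E := fun h => hεE ε h ε hεk (by ring)
    have hint : IsIntegral ℚ ε := (isTotallyPositive_of_sq_add_one ht hε).1.isIntegral
    refine ⟨k₂, insert ε E, by rw [Finset.card_insert_of_notMem hεnE, hcard], ?_, hkk₁.trans hle,
      ?_, ?_, ?_, ?_⟩
    · have : FiniteDimensional k₁ (IntermediateField.adjoin k₁ {ε}) :=
        IntermediateField.adjoin.finiteDimensional (hint.tower_top)
      exact FiniteDimensional.trans ℚ k₁ (IntermediateField.adjoin k₁ {ε})
    · change (IntermediateField.adjoin k₁ {ε}).restrictScalars ℚ ≤ _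
      have h1 : k₁ ≤ IntermediateField.adjoin ℚ (k ∪ (insert ε E : Finset ℂ) : Set ℂ) :=
        hk₁.trans (IntermediateField.adjoin.mono _ _ _ (by
          rw [Finset.coe_insert]
          exact Set.union_subset_union_right _ (Set.subset_insert _ _)))
      refine (IntermediateField.restrictScalars_adjoin ℚ k₁ {ε}).trans_le ?_
      rw [IntermediateField.adjoin_le_iff]
      rintro x (hx | rfl)
      · exact h1 hx
      · exact IntermediateField.subset_adjoin ℚ _ (Or.inr (by simp))
    · intro x hx hxS
      have hxS' : x ∈ S ⊔ k₁ ⊔ IntermediateField.adjoin ℚ (r '' E) :=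
        (le_sup_left.trans le_sup_left : S ≤ _) hxS
      exact hdisj x (hd x hx hxS') hxS
    · intro e he
      rcases Finset.mem_insert.mp he with rfl | he
      · exact ⟨hεk, t, ht, hε⟩
      · exact ⟨hle (hE e he).1, (hE e he).2⟩
    · intro a ha b hb hab s hsk
      rcases Finset.mem_insert.mp ha with ha | ha <;> rcases Finset.mem_insert.mp hb with hb | hb
      · exact absurd (ha.trans hb.symm) hab
      · exact ha ▸ hεE b hb s hsk
      · rw [mul_comm]
        exact hb ▸ hεE a ha s hsk
      · intro h
        have hr' : ∀ e ∈ E, r e ∈ S ⊔ k₁ ⊔ IntermediateField.adjoin ℚ (r '' E) := fun e he =>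
          le_sup_right (a := S ⊔ k₁) (IntermediateField.subset_adjoin ℚ _ ⟨e, he, rfl⟩)
        have hrr := mul_mem (hr' a ha) (hr' b hb)
        refine hsq a ha b hb hab s (hd s hsk ?_) h
        rw [← hr a, ← hr b, ← mul_pow, sq_eq_sq_iff_eq_or_eq_neg] at h
        rcases h with rfl | rfl
        · exact hrr
        · exact neg_mem hrr

lemma exists_ringHom_extension {F L : Type*} [Field F] [Field L] [Algebra F L]
    [Algebra.IsAlgebraic F L] (φ : F →+* ℂ) :
    ∃ ψ : L →+* ℂ, ∀ x, ψ (algebraMap F L x) = φ x := by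
  let _ := φ.toAlgebra
  let ψ : L →ₐ[F] ℂ := IsAlgClosed.lift
  exact ⟨ψ.toRingHom, fun x => ψ.commutes x⟩

section TotallyReal

variable {K : Subfield ℂ}

lemma aeval_minpoly_ringHom (φ : K →+* ℂ) (x : K) : aeval (φ x) (minpoly ℚ (x : ℂ)) = 0 := by
  have h := minpoly.algebraMap_eq (A := ℚ) (B := K) (B' := ℂ) (algebraMap K ℂ).injective x
  change minpoly ℚ (x : ℂ) = _ at h
  rw [h]
  change aeval (φ.toRatAlgHom x) _ = 0
  rw [aeval_algHom_apply, minpoly.aeval, map_zero]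

/-- Every embedding of a totally real field induces a real-valued homomorphism on its integers. -/
lemma exists_real_ringHom (hK : ∀ x : K, IsTotallyRealNum x) (φ : K →+* ℂ) :
    ∃ ρ : 𝓞 K →+* ℝ, ∀ x, (ρ x : ℂ) = φ x := by
  have h : ∀ x : K, ((φ x).re : ℂ) = φ x := fun x =>
    Complex.ext (by simp) (by simpa using ((hK x).2 _ (aeval_minpoly_ringHom φ x)).symm)
  refine ⟨{ toFun := fun x => (φ x).re
            map_one' := by simp
            map_zero' := by simp
            map_add' := fun x y => by simp
            map_mul' := fun x y => ?_ }, fun x => h x⟩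
  apply Complex.ofReal_injective
  push_cast
  rw [h, h, h]
  simp

lemma QuadLattice.map_form_pos {Λ : QuadLattice (𝓞 K)} (hΛ : Λ.IsUniversal K) {φ : K →+* ℂ}
    {ρ : 𝓞 K →+* ℝ} (hρ : ∀ x, (ρ x : ℂ) = φ x) (v : Λ.carrier) (hv : v ≠ 0) :
    0 < ρ (Λ.form v) := by
  have := ((hΛ.1 v hv).2 _ (aeval_minpoly_ringHom φ (Λ.form v))).1
  rwa [← hρ, Complex.ofReal_re] at this

/-- In an algebraic extension of a number field `F`, the integers of `F` all of whose conjugates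
are bounded form a finite set. -/
lemma finite_integers_of_norm_le {L : Type*} [Field L] [CharZero L] [Algebra ℚ L]
    [Algebra.IsAlgebraic ℚ L]
    (F : IntermediateField ℚ L) [FiniteDimensional ℚ F] (c : 𝓞 L) (hc : (c : L) ∈ F) :
    {r : 𝓞 L | (r : L) ∈ F ∧ ∀ φ : L →+* ℂ, ‖φ r‖ ^ 2 ≤ ‖φ c‖}.Finite := by
  have : NumberField F := 
    { to_charZero := inferInstance
      to_finiteDimensional := by
        convert ‹FiniteDimensional ℚ F›
        exact Subsingleton.elim _ _ }
  have : Algebra.IsAlgebraic F L := Algebra.IsAlgebraic.tower_top (K := ℚ) F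
  have hfin := (Embeddings.finite_of_norm_le F ℂ (∑ φ : F →+* ℂ, (1 + ‖φ ⟨c, hc⟩‖))).image
    (algebraMap F L)
  refine (hfin.preimage (f := algebraMap (𝓞 L) L)
    (RingOfIntegers.coe_injective).injOn).subset ?_
  rintro r ⟨hr, hφ⟩
  refine ⟨⟨r, hr⟩, ⟨?_, fun φ => ?_⟩, rfl⟩
  · exact (isIntegral_algHom_iff (algebraMap F L).toIntAlgHom (algebraMap F L).injective).mp r.2
  · obtain ⟨ψ, hψ⟩ := exists_ringHom_extension (L := L) φ
    have h1 : ‖φ ⟨r, hr⟩‖ ^ 2 ≤ ‖φ ⟨c, hc⟩‖ := by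
      rw [← hψ, ← hψ]
      exact hφ ψ
    calc ‖φ ⟨r, hr⟩‖ ≤ 1 + ‖φ ⟨c, hc⟩‖ := by nlinarith [sq_nonneg (‖φ ⟨r, hr⟩‖ - 1)]
      _ ≤ _ := Finset.single_le_sum (f := fun φ : F →+* ℂ => 1 + ‖φ ⟨c, hc⟩‖)
          (fun _ _ => by positivity) (Finset.mem_univ φ)

theorem QuadLattice.card_units_le (hK : ∀ x : K, IsTotallyRealNum x) {Λ : QuadLattice (𝓞 K)}
    (hΛ : Λ.IsUniversal K) {n : ℕ} (e : Fin n → Λ.carrier)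
    (he : Submodule.span (𝓞 K) (Set.range e) = ⊤) {ι : Type*} [Fintype ι] (ε : ι → (𝓞 K)ˣ)
    (hpos : ∀ i, IsTotallyPositive (((ε i : 𝓞 K) : K) : ℂ))
    (hε : ∀ i j, i ≠ j → ∀ s : 𝓞 K, s ^ 2 ≠ 4 * (ε i * ε j)) : Fintype.card ι ≤ n := by
  classical
  obtain ⟨ρ, hρ⟩ := exists_real_ringHom hK (algebraMap K ℂ)
  have hρinj : Function.Injective ρ := fun x y h => by
    apply RingOfIntegers.coe_injective
    apply (algebraMap K ℂ).injective
    rw [← hρ, ← hρ, h]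
  choose v hv using fun i => hΛ.2 (ε i) (hpos i)
  have hspan : ∀ i, ∃ a : Fin n → 𝓞 K, ∑ k, a k • e k = v i := fun i =>
    (Submodule.mem_span_range_iff_exists_fun _).mp (he ▸ Submodule.mem_top)
  choose a ha using hspan
  have halg : Algebra.IsAlgebraic ℚ K := ⟨fun x => by
    have := (hK x).1
    exact (isAlgebraic_algebraMap_iff (A := ℂ) (algebraMap K ℂ).injective).mp this⟩
  -- a number field containing all the relevant coefficients
  let A : Set K := Set.range (fun i => ((ε i : 𝓞 K) : K)) ∪
    Set.range (fun p : ι × Fin n => ((a p.1 p.2 : 𝓞 K) : K)) ∪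
    Set.range (fun p : Fin n × Fin n =>
      ((QuadraticMap.polar Λ.form (e p.1) (e p.2) : 𝓞 K) : K)) ∪
    Set.range (fun k => ((Λ.form (e k) : 𝓞 K) : K))
  have hAfin : A.Finite := (((Set.finite_range _).union (Set.finite_range _)).union
    (Set.finite_range _)).union (Set.finite_range _)
  let F := IntermediateField.adjoin ℚ A
  have hF : FiniteDimensional ℚ F := by
    have := hAfin.to_subtype
    exact IntermediateField.finiteDimensional_adjoin fun x _ => (halg.isAlgebraic x).isIntegral
  have hAF : ∀ x ∈ A, x ∈ F := fun x hx => IntermediateField.subset_adjoin ℚ A hx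
  let S : Subring (𝓞 K) := F.toSubfield.toSubring.comap (algebraMap (𝓞 K) K)
  have hS : ∀ x : 𝓞 K, x ∈ S ↔ (x : K) ∈ F := fun x => Iff.rfl
  have hεS : ∀ i, (ε i : 𝓞 K) ∈ S := fun i => hAF _ (Or.inl (Or.inl (Or.inl ⟨i, rfl⟩)))
  have haS : ∀ i k, a i k ∈ S := fun i k => hAF _ (Or.inl (Or.inl (Or.inr ⟨(i, k), rfl⟩)))
  have hpS : ∀ k l, QuadraticMap.polar Λ.form (e k) (e l) ∈ S := fun k l =>
    hAF _ (Or.inl (Or.inr ⟨(k, l), rfl⟩))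
  have hqS : ∀ k, Λ.form (e k) ∈ S := fun k => hAF _ (Or.inr ⟨k, rfl⟩)
  have hεinv : ∀ i, ((ε i)⁻¹ : (𝓞 K)ˣ).val ∈ S := fun i => by
    rw [hS]
    have h : (((ε i)⁻¹ : (𝓞 K)ˣ).val : K) = (((ε i : 𝓞 K) : K))⁻¹ := by
      apply eq_inv_of_mul_eq_one_left
      rw [← map_mul, Units.inv_mul, map_one]
    rw [h]
    exact inv_mem (hεS i)
  let M : Submodule S Λ.carrier := Submodule.span S (Set.range e)
  have hMe : ∀ k, e k ∈ M := fun k => Submodule.subset_span ⟨k, rfl⟩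
  have hMsmul : ∀ r ∈ S, ∀ x ∈ M, r • x ∈ M := fun r hr x hx => M.smul_mem ⟨r, hr⟩ hx
  have hpolar1 : ∀ k, ∀ y ∈ M, QuadraticMap.polar Λ.form y (e k) ∈ S := by
    intro k y hy
    induction hy using Submodule.span_induction with
    | mem y hy =>
      obtain ⟨l, rfl⟩ := hy
      exact hpS l k
    | zero => rw [QuadraticMap.polar_zero_left]; exact zero_mem S
    | add x y _ _ hx hy => rw [QuadraticMap.polar_add_left]; exact add_mem hx hy
    | smul r x _ hx =>
      change QuadraticMap.polar Λ.form ((r : 𝓞 K) • x) (e k) ∈ S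
      rw [QuadraticMap.polar_smul_left]
      exact mul_mem r.2 hx
  have hpolar : ∀ x ∈ M, ∀ y ∈ M, QuadraticMap.polar Λ.form x y ∈ S := by
    intro x hx y hy
    induction hy using Submodule.span_induction with
    | mem y hy =>
      obtain ⟨l, rfl⟩ := hy
      exact hpolar1 l x hx
    | zero => rw [QuadraticMap.polar_zero_right]; exact zero_mem S
    | add y z _ _ hy hz => rw [QuadraticMap.polar_add_right]; exact add_mem hy hz
    | smul r y _ hy =>
      change QuadraticMap.polar Λ.form x ((r : 𝓞 K) • y) ∈ S
      rw [QuadraticMap.polar_smul_right]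
      exact mul_mem r.2 hy
  refine QuadraticMap.card_le_of_reflection_stable hρinj (QuadLattice.map_form_pos hΛ hρ) e he ε hε
    (fun i => {x | x ∈ M ∧ Λ.form x = ε i}) (fun i => ?_) (fun i => ⟨v i, ?_, hv i⟩)
    (fun i x hx => hx.2) (fun i j x hx y hy => ⟨?_, ?_⟩)
  · refine Set.Finite.of_finite_image (f := fun x k => QuadraticMap.polar Λ.form x (e k)) ?_ ?_
    · refine (Set.Finite.pi' (t := fun k => {r : 𝓞 K | (r : K) ∈ F ∧ ∀ φ : K →+* ℂ,
        ‖φ r‖ ^ 2 ≤ ‖φ ((4 * ε i * Λ.form (e k) : 𝓞 K) : K)‖}) fun k =>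
          finite_integers_of_norm_le F _ ((hS _).mp
            (mul_mem (mul_mem (ofNat_mem S 4) (hεS i)) (hqS k)))).subset ?_
      rintro _ ⟨x, ⟨hxM, hx⟩, rfl⟩ k
      refine ⟨hpolar1 k x hxM, fun φ => ?_⟩
      obtain ⟨σ, hσ⟩ := exists_real_ringHom hK φ
      have h := QuadraticMap.polar_sq_le (QuadLattice.map_form_pos hΛ hσ) x (e k)
      rw [← hσ, ← hσ, Complex.norm_real, Complex.norm_real, Real.norm_eq_abs, sq_abs, ← hx]
      refine h.trans (le_trans (le_of_eq ?_) (le_abs_self _))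
      rw [map_mul, map_mul, map_ofNat]
    · intro x _ y _ hxy
      rw [← sub_eq_zero]
      refine QuadraticMap.eq_zero_of_polar_eq_zero (QuadLattice.map_form_pos hΛ hρ) he fun k => ?_
      rw [QuadraticMap.polar_sub_left, sub_eq_zero]
      exact congrFun hxy k
  · rw [← ha i]
    exact sum_mem fun k _ => hMsmul _ (haS i k) _ (hMe k)
  · exact sub_mem hx.1 (hMsmul _ (mul_mem (hεinv j) (hpolar x hx.1 y hy.1)) y hy.1)
  · have h := QuadraticMap.map_add Λ.form x
      (-((((ε j)⁻¹ : (𝓞 K)ˣ) * QuadraticMap.polar Λ.form x y) • y))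
    rw [← sub_eq_add_neg, QuadraticMap.map_neg, QuadraticMap.map_smul,
      QuadraticMap.polar_neg_right, QuadraticMap.polar_smul_right, hy.2, hx.2, smul_eq_mul,
      smul_eq_mul] at h
    rw [h]
    linear_combination (((ε j)⁻¹ : (𝓞 K)ˣ) : 𝓞 K) * QuadraticMap.polar Λ.form x y ^ 2 *
      (ε j).inv_mul

end TotallyReal

lemma isOpen_mem_totallyRealFields (a : ℂ) : IsOpen {K : TotallyRealFields | a ∈ K.1} := by
  by_cases h : IsTotallyRealNum a
  · exact TopologicalSpace.isOpen_generateFrom_of_mem ⟨a, h, Or.inl rfl⟩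
  · convert isOpen_empty
    exact Set.eq_empty_of_forall_notMem fun K hK => h (K.2 ⟨a, hK⟩)

lemma isOpen_notMem_totallyRealFields (a : ℂ) : IsOpen {K : TotallyRealFields | a ∉ K.1} := by
  by_cases h : IsTotallyRealNum a
  · exact TopologicalSpace.isOpen_generateFrom_of_mem ⟨a, h, Or.inr rfl⟩
  · convert isOpen_univ
    exact Set.eq_univ_of_forall fun K hK => h (K.2 ⟨a, hK⟩)

lemma exists_finite_of_isOpen {W : Set TotallyRealFields} (hW : IsOpen W) {K : TotallyRealFields}
    (hK : K ∈ W) :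
    ∃ A B : Set ℂ, A.Finite ∧ B.Finite ∧ (∀ b ∈ B, IsTotallyRealNum b) ∧ (∀ a ∈ A, a ∈ K.1) ∧
      (∀ b ∈ B, b ∉ K.1) ∧
      ∀ L : TotallyRealFields, (∀ a ∈ A, a ∈ L.1) → (∀ b ∈ B, b ∉ L.1) → L ∈ W := by
  induction hW with
  | basic U hU =>
    obtain ⟨a, ha, rfl | rfl⟩ := hU
    · exact ⟨{a}, ∅, by simp, by simp, by simp, by simpa using hK, by simp, by simp⟩
    · exact ⟨∅, {a}, by simp, by simp, by simpa using ha, by simp, by simpa using hK, by simp⟩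
  | univ => exact ⟨∅, ∅, by simp, by simp, by simp, by simp, by simp, by simp⟩
  | inter U V _ _ ihU ihV =>
    obtain ⟨A, B, hA, hB, hBr, hAK, hBK, h⟩ := ihU hK.1
    obtain ⟨A', B', hA', hB', hBr', hAK', hBK', h'⟩ := ihV hK.2
    refine ⟨A ∪ A', B ∪ B', hA.union hA', hB.union hB', ?_, ?_, ?_, fun L h1 h2 => ⟨?_, ?_⟩⟩
    · rintro b (hb | hb)
      exacts [hBr b hb, hBr' b hb]
    · rintro b (hb | hb)
      exacts [hAK b hb, hAK' b hb]
    · rintro b (hb | hb)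
      exacts [hBK b hb, hBK' b hb]
    · exact h L (fun a ha => h1 a (Or.inl ha)) (fun a ha => h2 a (Or.inl ha))
    · exact h' L (fun a ha => h1 a (Or.inr ha)) (fun a ha => h2 a (Or.inr ha))
  | sUnion 𝒰 _ ih =>
    obtain ⟨U, hU, hKU⟩ := hK
    obtain ⟨A, B, hA, hB, hBr, hAK, hBK, h⟩ := ih U hU hKU
    exact ⟨A, B, hA, hB, hBr, hAK, hBK, fun L h1 h2 => ⟨U, hU, h L h1 h2⟩⟩

/-- Universal lattices with `n` generators do not exist over a field that contains `n + 1`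
totally positive units in distinct square classes. -/
lemma not_exists_universal {K : TotallyRealFields} {n : ℕ} {E : Finset ℂ} (hcard : E.card = n + 1)
    (hEK : ∀ ε ∈ E, ε ∈ K.1) (hE : ∀ ε ∈ E, ∃ t : ℕ, 3 ≤ t ∧ ε ^ 2 + 1 = t * ε)
    (hsq : ∀ ε ∈ E, ∀ e ∈ E, ε ≠ e → ∀ s ∈ K.1, s ^ 2 ≠ ε * e) :
    ¬ ∃ Λ : QuadLattice (𝓞 K.1), Λ.IsUniversal K.1 ∧
      ∃ e : Fin n → Λ.carrier, Submodule.span (𝓞 K.1) (Set.range e) = ⊤ := by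
  rintro ⟨Λ, hΛ, e, he⟩
  have hunit : ∀ ε : E, ∃ u : (𝓞 K.1)ˣ, (((u : 𝓞 K.1) : K.1) : ℂ) = ε := by
    rintro ⟨ε, hε⟩
    obtain ⟨t, ht, h⟩ := hE ε hε
    have h' : (⟨ε, hEK ε hε⟩ : K.1) ^ 2 + 1 = t * ⟨ε, hEK ε hε⟩ := by
      apply Subtype.ext
      simpa using h
    let u : 𝓞 K.1 := ⟨⟨ε, hEK ε hε⟩, isIntegral_of_sq_add_one h'⟩
    have hu : u * (t - u) = 1 := by
      apply RingOfIntegers.coe_injective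
      have hu' : (algebraMap (𝓞 K.1) K.1) u = ⟨ε, hEK ε hε⟩ := rfl
      rw [map_mul, map_sub, map_natCast, map_one, hu']
      linear_combination -h'
    exact ⟨Units.mkOfMulEqOne u _ hu, rfl⟩
  choose u hu using hunit
  have h := QuadLattice.card_units_le K.2 hΛ e he u (fun ε => by
    obtain ⟨t, ht, h⟩ := hE ε ε.2
    rw [hu]
    exact isTotallyPositive_of_sq_add_one ht h) (fun ε δ hne s hs => by
    refine hsq ε ε.2 δ δ.2 (Subtype.val_injective.ne hne) ((s : K.1) / 2 : K.1)
      ((s : K.1) / 2 : K.1).2 ?_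
    have h1 := congrArg (fun x : 𝓞 K.1 => (algebraMap K.1 ℂ) (algebraMap (𝓞 K.1) K.1 x)) hs
    simp only [map_mul, map_pow, map_ofNat] at h1
    rw [← hu ε, ← hu δ]
    change (algebraMap K.1 ℂ) (_ / 2) ^ 2 = _
    rw [map_div₀, map_ofNat, div_pow, h1]
    change 4 * ((((u ε : 𝓞 K.1) : K.1) : ℂ) * (((u δ : 𝓞 K.1) : K.1) : ℂ)) / 2 ^ 2 = _
    ring)
  rw [Fintype.card_coe, hcard] at h
  omega

/-- Universal lattices with a bounded number of generators exist only over a nowhere dense set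
of totally real fields. -/
lemma isNowhereDense_universal (n : ℕ) :
    IsNowhereDense {K : TotallyRealFields | ∃ Λ : QuadLattice (𝓞 K.1), Λ.IsUniversal K.1 ∧
      ∃ e : Fin n → Λ.carrier, Submodule.span (𝓞 K.1) (Set.range e) = ⊤} := by
  rw [IsNowhereDense, Set.eq_empty_iff_forall_notMem]
  intro K hK
  obtain ⟨A, B, hA, hB, hBr, hAK, hBK, hW⟩ := exists_finite_of_isOpen isOpen_interior hK
  have hfin : ∀ {C : Set ℂ}, C.Finite → (∀ c ∈ C, IsTotallyRealNum c) →
      FiniteDimensional ℚ (IntermediateField.adjoin ℚ C) := by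
    intro C hC h
    have := hC.to_subtype
    exact IntermediateField.finiteDimensional_adjoin fun c hc => (h c hc).1.isIntegral
  have hAr : ∀ a ∈ A, IsTotallyRealNum a := fun a ha => K.2 ⟨a, hAK a ha⟩
  have := hfin (hA.union hB) (by
    rintro c (hc | hc)
    exacts [hAr c hc, hBr c hc])
  obtain ⟨k', E, hcard, -, hk, hk', hdisj, hE, hsq⟩ := exists_units_adjoin (n + 1)
    (IntermediateField.adjoin ℚ A) (IntermediateField.adjoin ℚ (A ∪ B))
    (IntermediateField.adjoin.mono ℚ _ _ Set.subset_union_left)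
  choose r hr using fun z : ℂ => IsAlgClosed.exists_pow_nat_eq z (n := 2) (by norm_num)
  let L : TotallyRealFields := ⟨k'.toSubfield, fun x =>
    isTotallyRealNum_of_mem_adjoin (by
      rintro c (hc | hc)
      · exact isTotallyRealNum_of_mem_adjoin hAr hc
      · obtain ⟨t, ht, h⟩ := (hE c hc).2
        exact (isTotallyPositive_of_sq_add_one ht h).isTotallyRealNum) (hk' x.2)⟩
  have hAk : ∀ x ∈ IntermediateField.adjoin ℚ A, x ∈ K.1 := by
    intro x hx
    induction hx using IntermediateField.adjoin_induction with
    | mem a ha => exact hAK a ha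
    | algebraMap r => exact SubfieldClass.ratCast_mem K.1 r
    | add a b _ _ ha hb => exact add_mem ha hb
    | inv a _ ha => exact inv_mem ha
    | mul a b _ _ ha hb => exact mul_mem ha hb
  have hLW : L ∈ interior (closure {K : TotallyRealFields | ∃ Λ : QuadLattice (𝓞 K.1),
      Λ.IsUniversal K.1 ∧ ∃ e : Fin n → Λ.carrier,
        Submodule.span (𝓞 K.1) (Set.range e) = ⊤}) :=
    hW L (fun a ha => hk (IntermediateField.subset_adjoin ℚ A ha)) fun b hb hbL =>
      hBK b hb (hAk b (hdisj b hbL (IntermediateField.subset_adjoin ℚ _ (Or.inr hb))))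
  let V : Set TotallyRealFields := (⋂ ε ∈ E, {K | ε ∈ K.1}) ∩
    ⋂ ε ∈ E, ⋂ e ∈ E, ⋂ _ : ε ≠ e, {K | r (ε * e) ∉ K.1}
  have hV : IsOpen V := by
    refine (isOpen_biInter_finset fun ε _ => isOpen_mem_totallyRealFields ε).inter
      (isOpen_biInter_finset fun ε _ => isOpen_biInter_finset fun e _ => ?_)
    by_cases h : ε = e
    · simp [h]
    · simpa [h] using isOpen_notMem_totallyRealFields (r (ε * e))
  have hLV : L ∈ V := by
    simp only [V, Set.mem_inter_iff, Set.mem_iInter]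
    exact ⟨fun ε hε => (hE ε hε).1, fun ε hε e he hne h => hsq ε hε e he hne _ h (hr _)⟩
  obtain ⟨K', hK'V, hK'⟩ := mem_closure_iff.mp (interior_subset hLW) V hV hLV
  simp only [V, Set.mem_inter_iff, Set.mem_iInter] at hK'V
  refine not_exists_universal hcard hK'V.1 (fun ε hε => (hE ε hε).2) ?_ hK'
  intro ε hε e he hne s hs h
  refine hK'V.2 ε hε e he hne ?_
  rw [← hr (ε * e), sq_eq_sq_iff_eq_or_eq_neg] at h
  rcases h with h | h
  · exact h ▸ hs
  · have := neg_mem hs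
    rw [h, neg_neg] at this
    exact this

/-- The set of totally real fields which admit a universal quadratic lattice is meager in `𝒳`
with the constructible topology. -/
theorem stmt_17 :
    IsMeagre {K : TotallyRealFields | ∃ Λ : QuadLattice (𝓞 ↥K.1), Λ.IsUniversal K.1} := by
  refine (isMeagre_iUnion fun n => (isNowhereDense_universal n).isMeagre).mono ?_
  rintro K ⟨Λ, hΛ⟩
  have := Λ.finite
  obtain ⟨n, e, he⟩ := Module.Finite.exists_fin (R := 𝓞 K.1) (M := Λ.carrier)
  exact Set.mem_iUnion.mpr ⟨n, Λ, hΛ, e, he⟩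

end
end
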